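/- Let α ∈ (0,1) be a Liouville number and let λ > 1. For every r ∈ ℕ there exists a lift f of an orientation-preserving C^∞ circle diffeomorphism with rotation number ρ(f) = α such that d_r(f, R_α) < 2^{−r} and the circle diffeomorphism induced by f has ratio set r(f) = {λⁿ : n ∈ ℤ} ∪ {0} (i.e. it is of type III_λ). -/

import Mathlib

noncomputable section
open MeasureTheory Filter Topology

/-- A lift of an orientation-preserving `C^∞` circle diffeomorphism: a `C^∞` map
`f : ℝ → ℝ` with `f (x+1) = f x + 1` and everywhere positive derivative. -/
def IsCircleDiffeoLift (f : ℝ → ℝ) : Prop :=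
  ContDiff ℝ (⊤ : ℕ∞) f ∧ (∀ x : ℝ, f (x + 1) = f x + 1) ∧ ∀ x : ℝ, 0 < deriv f x

/-- The `C^r` norm `‖φ‖_r = max_{0 ≤ i ≤ r} sup_x |φ^{(i)}(x)|`. -/
def CrNorm (r : ℕ) (φ : ℝ → ℝ) : ℝ :=
  (Finset.range (r + 1)).sup' (Finset.nonempty_range_iff.mpr r.succ_ne_zero)
    fun i => ⨆ x : ℝ, |iteratedDeriv i φ x|

/-- `d_r(f, g) = max {‖f - g‖_r, ‖f⁻¹ - g⁻¹‖_r}`. -/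
def liftDist (r : ℕ) (f g : ℝ → ℝ) : ℝ :=
  max (CrNorm r (fun x => f x - g x))
    (CrNorm r (fun x => Function.invFun f x - Function.invFun g x))

/-- `|f|_r = max {‖f - id‖_r, ‖f⁻¹ - id‖_r, 1}`. -/
def liftNorm (r : ℕ) (f : ℝ → ℝ) : ℝ :=
  max (max (CrNorm r (fun x => f x - x)) (CrNorm r (fun x => Function.invFun f x - x))) 1

/-- The lift `x ↦ x + a` of the rotation by `a`. -/
def RotLift (a : ℝ) : ℝ → ℝ := fun x => x + a

/-- The rotation number of the circle diffeomorphism induced by the lift `f` equals `a`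
(mod 1): the translation number `lim (fⁿ(0) - 0)/n` equals `a + k` for some integer `k`. -/
def HasRotationNumber (f : ℝ → ℝ) (a : ℝ) : Prop :=
  ∃ k : ℤ, Tendsto (fun n : ℕ => f^[n] 0 / (n : ℝ)) atTop (nhds (a + k))

/-- The lift of the `i`-th iterate (`i ∈ ℤ`) of the circle diffeomorphism induced by `f`. -/
def zpowLift (f : ℝ → ℝ) : ℤ → ℝ → ℝ := fun i =>
  if 0 ≤ i then f^[i.toNat] else (Function.invFun f)^[(-i).toNat]

/-- The ratio set of a circle diffeomorphism, described through the family `Fz i` of its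
iterates (`i ∈ ℤ`) and the family `D i` of the derivatives of its iterates: `t ≥ 0` lies in
the ratio set iff for every Borel `A` of positive Haar measure and every `ε > 0` there are a
Borel `B ⊆ A` of positive measure and `i ∈ ℤ` with `Fz i '' B ⊆ A` and `|D i x - t| < ε`
on `B`. -/
def ratioSet (Fz : ℤ → UnitAddCircle → UnitAddCircle) (D : ℤ → UnitAddCircle → ℝ) : Set ℝ :=
  {t : ℝ | 0 ≤ t ∧ ∀ A : Set UnitAddCircle, MeasurableSet A → 0 < volume A →
    ∀ ε : ℝ, 0 < ε → ∃ B : Set UnitAddCircle, MeasurableSet B ∧ B ⊆ A ∧ 0 < volume B ∧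
      ∃ i : ℤ, Fz i '' B ⊆ A ∧ ∀ x ∈ B, |D i x - t| < ε}

/-- A lift of an orientation-preserving `C¹` circle diffeomorphism. -/
def IsC1CircleLift (f : ℝ → ℝ) : Prop :=
  ContDiff ℝ 1 f ∧ (∀ x : ℝ, f (x + 1) = f x + 1) ∧ ∀ x : ℝ, 0 < deriv f x

theorem Function.Periodic.uniformContinuous {g : ℝ → ℝ} (hp : Function.Periodic g 1)
    (hc : Continuous g) : UniformContinuous g := by
  have : Fact (0 < (1 : ℝ)) := ⟨one_pos⟩
  have hl : Continuous (hp.lift : AddCircle (1 : ℝ) → ℝ) :=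
    continuous_coinduced_dom.mpr hc
  have hu := CompactSpace.uniformContinuous_of_continuous hl
  have hm : UniformContinuous ((↑) : ℝ → AddCircle (1 : ℝ)) :=
    uniformContinuous_of_continuousAt_zero (QuotientAddGroup.mk' (AddSubgroup.zmultiples (1 : ℝ)))
      (AddCircle.continuous_mk' (1 : ℝ)).continuousAt
  exact hu.comp hm

theorem Function.Periodic.exists_abs_le {g : ℝ → ℝ} (hp : Function.Periodic g 1)
    (hc : Continuous g) : ∃ C, ∀ x, |g x| ≤ C := by
  obtain ⟨C, hC⟩ := (hp.isBounded_of_continuous one_ne_zero hc).exists_norm_le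
  exact ⟨C, fun x => hC _ ⟨x, rfl⟩⟩

theorem Function.Periodic.exists_pos_le {g : ℝ → ℝ} (hp : Function.Periodic g 1)
    (hc : Continuous g) (h0 : ∀ x, 0 < g x) : ∃ c, 0 < c ∧ ∀ x, c ≤ g x := by
  obtain ⟨C, hC⟩ := Function.Periodic.exists_abs_le (g := fun x => (g x)⁻¹)
    (fun x => by simp only [hp x]) (hc.inv₀ fun x => (h0 x).ne')
  have hC0 : 0 < C := (abs_pos.mpr (inv_ne_zero (h0 0).ne')).trans_le (hC 0)
  refine ⟨C⁻¹, inv_pos.mpr hC0, fun x => ?_⟩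
  have := hC x
  rw [abs_of_pos (inv_pos.mpr (h0 x))] at this
  exact inv_le_of_inv_le₀ (h0 x) this

namespace IsCircleDiffeoLift

variable {f g : ℝ → ℝ}

theorem continuous (hf : IsCircleDiffeoLift f) : Continuous f := hf.1.continuous

theorem differentiable (hf : IsCircleDiffeoLift f) : Differentiable ℝ f :=
  hf.1.differentiable (by simp)

theorem hasDerivAt (hf : IsCircleDiffeoLift f) (x : ℝ) : HasDerivAt f (deriv f x) x :=
  (hf.differentiable x).hasDerivAt

theorem strictMono (hf : IsCircleDiffeoLift f) : StrictMono f :=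
  strictMono_of_deriv_pos hf.2.2

theorem continuous_deriv (hf : IsCircleDiffeoLift f) : Continuous (deriv f) :=
  hf.1.continuous_deriv (by simp)

theorem deriv_periodic (hf : IsCircleDiffeoLift f) : Function.Periodic (deriv f) 1 := fun x => by
  rw [← deriv_comp_add_const, funext hf.2.1, deriv_add_const]

theorem exists_pos_le_deriv (hf : IsCircleDiffeoLift f) : ∃ c, 0 < c ∧ ∀ x, c ≤ deriv f x :=
  hf.deriv_periodic.exists_pos_le hf.continuous_deriv hf.2.2

theorem exists_deriv_le (hf : IsCircleDiffeoLift f) : ∃ C, 0 < C ∧ ∀ x, deriv f x ≤ C := by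
  obtain ⟨C, hC⟩ := hf.deriv_periodic.exists_abs_le hf.continuous_deriv
  exact ⟨C, (hf.2.2 0).trans_le ((le_abs_self _).trans (hC 0)),
    fun x => (le_abs_self _).trans (hC x)⟩

theorem map_add_int (hf : IsCircleDiffeoLift f) (x : ℝ) (k : ℤ) : f (x + k) = f x + k := by
  have h : Function.Periodic (fun x => f x - x) 1 := fun x => by simp only [hf.2.1 x]; ring
  have := h.int_mul k x
  simp only [mul_one] at this
  linarith

theorem surjective (hf : IsCircleDiffeoLift f) : Function.Surjective f := by
  intro y
  have h1 : f (⌊y - f 0⌋ : ℤ) ≤ y := by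
    have := hf.map_add_int 0 ⌊y - f 0⌋
    rw [zero_add] at this
    linarith [Int.floor_le (y - f 0)]
  have h2 : y ≤ f (⌈y - f 0⌉ : ℤ) := by
    have := hf.map_add_int 0 ⌈y - f 0⌉
    rw [zero_add] at this
    linarith [Int.le_ceil (y - f 0)]
  exact mem_range_of_exists_le_of_exists_ge hf.continuous ⟨_, h1⟩ ⟨_, h2⟩

theorem bijective (hf : IsCircleDiffeoLift f) : Function.Bijective f :=
  ⟨hf.strictMono.injective, hf.surjective⟩

theorem invFun_apply (hf : IsCircleDiffeoLift f) (x : ℝ) : Function.invFun f (f x) = x :=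
  Function.leftInverse_invFun hf.strictMono.injective x

theorem apply_invFun (hf : IsCircleDiffeoLift f) (x : ℝ) : f (Function.invFun f x) = x :=
  Function.rightInverse_invFun hf.surjective x

theorem invFun_eq_of_leftInverse (hf : IsCircleDiffeoLift f) (h : ∀ x, f (g x) = x) :
    Function.invFun f = g :=
  funext fun x => hf.strictMono.injective (by rw [hf.apply_invFun, h])

theorem invFun (hf : IsCircleDiffeoLift f) : IsCircleDiffeoLift (Function.invFun f) := by
  have hs : Function.invFun f =
      (StrictMono.orderIsoOfSurjective f hf.strictMono hf.surjective).symm :=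
    hf.invFun_eq_of_leftInverse
      (StrictMono.orderIsoOfSurjective f hf.strictMono hf.surjective).apply_symm_apply
  have hc : Continuous (Function.invFun f) := by
    rw [hs]; exact OrderIso.continuous _
  have hd : ∀ x, HasDerivAt (Function.invFun f) (deriv f (Function.invFun f x))⁻¹ x := fun x =>
    HasDerivAt.of_local_left_inverse hc.continuousAt (hf.hasDerivAt _) (hf.2.2 _).ne'
      (Eventually.of_forall hf.apply_invFun)
  refine ⟨?_, fun x => hf.strictMono.injective ?_, fun x => ?_⟩
  · let e : ℝ ≃ₜ ℝ :=
      (StrictMono.orderIsoOfSurjective f hf.strictMono hf.surjective).toHomeomorph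
    have := e.contDiff_symm_deriv (f' := deriv f) (n := (⊤ : ℕ∞)) (fun x => (hf.2.2 x).ne')
      hf.hasDerivAt hf.1
    rw [hs]
    exact this
  · rw [hf.apply_invFun, hf.2.1, hf.apply_invFun]
  · rw [(hd x).deriv]
    exact inv_pos.mpr (hf.2.2 _)

theorem comp (hf : IsCircleDiffeoLift f) (hg : IsCircleDiffeoLift g) :
    IsCircleDiffeoLift (fun x => f (g x)) := by
  refine ⟨hf.1.comp hg.1, fun x => by simp only [hg.2.1, hf.2.1], fun x => ?_⟩
  have h : HasDerivAt (fun x => f (g x)) _ x := (hf.hasDerivAt (g x)).comp x (hg.hasDerivAt x)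
  rw [h.deriv]
  exact mul_pos (hf.2.2 _) (hg.2.2 _)

theorem deriv_comp (hf : IsCircleDiffeoLift f) (hg : IsCircleDiffeoLift g) (x : ℝ) :
    deriv (fun x => f (g x)) x = deriv f (g x) * deriv g x :=
  ((hf.hasDerivAt (g x)).comp x (hg.hasDerivAt x)).deriv

theorem deriv_invFun (hf : IsCircleDiffeoLift f) (x : ℝ) :
    deriv (Function.invFun f) x = (deriv f (Function.invFun f x))⁻¹ := by
  have h := hf.deriv_comp hf.invFun x
  simp only [hf.apply_invFun, deriv_id''] at h
  exact eq_inv_of_mul_eq_one_right h.symm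

theorem iterate (hf : IsCircleDiffeoLift f) (n : ℕ) : IsCircleDiffeoLift f^[n] := by
  induction n with
  | zero => exact ⟨contDiff_id, fun x => rfl, fun x => by simp⟩
  | succ n ih => rw [Function.iterate_succ']; exact hf.comp ih

theorem zpowLift (hf : IsCircleDiffeoLift f) (i : ℤ) : IsCircleDiffeoLift (zpowLift f i) := by
  unfold _root_.zpowLift
  split_ifs
  · exact hf.iterate _
  · exact hf.invFun.iterate _

theorem zpowLift_eq (hf : IsCircleDiffeoLift f) (i : ℤ) :
    _root_.zpowLift f i = ⇑((Equiv.ofBijective f hf.bijective : Equiv.Perm ℝ) ^ i) := by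
  have h1 : ∀ n : ℕ, f^[n] = ⇑((Equiv.ofBijective f hf.bijective : Equiv.Perm ℝ) ^ n) := fun n => by
    rw [Equiv.Perm.coe_pow]; rfl
  have h2 : ∀ n : ℕ, (Function.invFun f)^[n] =
      ⇑((Equiv.ofBijective f hf.bijective : Equiv.Perm ℝ)⁻¹ ^ n) := fun n => by
    rw [Equiv.Perm.coe_pow]
    congr 1
    exact hf.invFun_eq_of_leftInverse
      (Equiv.ofBijective f hf.bijective).apply_symm_apply
  unfold _root_.zpowLift
  split_ifs with h
  · rw [h1]
    conv_rhs => rw [← Int.toNat_of_nonneg h, zpow_natCast]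
  · rw [h2, inv_pow]
    conv_rhs => rw [← neg_neg i, zpow_neg, ← Int.toNat_of_nonneg (by omega : 0 ≤ -i), zpow_natCast]

theorem zpowLift_add (hf : IsCircleDiffeoLift f) (i j : ℤ) (x : ℝ) :
    _root_.zpowLift f (i + j) x = _root_.zpowLift f i (_root_.zpowLift f j x) := by
  simp only [hf.zpowLift_eq, zpow_add, Equiv.Perm.mul_apply]

theorem zpowLift_neg_apply (hf : IsCircleDiffeoLift f) (i : ℤ) (x : ℝ) :
    _root_.zpowLift f (-i) (_root_.zpowLift f i x) = x := by
  rw [← hf.zpowLift_add]; simp [_root_.zpowLift]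

theorem zpowLift_apply_neg (hf : IsCircleDiffeoLift f) (i : ℤ) (x : ℝ) :
    _root_.zpowLift f i (_root_.zpowLift f (-i) x) = x := by
  rw [← hf.zpowLift_add]; simp [_root_.zpowLift]

theorem volume_image (hf : IsCircleDiffeoLift f) {s : Set ℝ} (hs : MeasurableSet s) :
    volume (f '' s) = ∫⁻ x in s, ENNReal.ofReal (deriv f x) := by
  have := lintegral_image_eq_lintegral_abs_deriv_mul (f := f) (f' := deriv f) hs
    (fun x _ => (hf.hasDerivAt x).hasDerivWithinAt) hf.strictMono.injective.injOn (fun _ => 1)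
  simpa [abs_of_pos (hf.2.2 _)] using this

theorem volume_image_le (hf : IsCircleDiffeoLift f) {s : Set ℝ} (hs : MeasurableSet s) {C : ℝ}
    (hC : ∀ x, deriv f x ≤ C) : volume (f '' s) ≤ ENNReal.ofReal C * volume s := by
  rw [hf.volume_image hs]
  calc _ ≤ ∫⁻ x in s, ENNReal.ofReal C :=
        lintegral_mono fun x => ENNReal.ofReal_le_ofReal (hC x)
    _ = _ := by simp

theorem le_volume_image (hf : IsCircleDiffeoLift f) {s : Set ℝ} (hs : MeasurableSet s) {c : ℝ}
    (hc : ∀ x, c ≤ deriv f x) : ENNReal.ofReal c * volume s ≤ volume (f '' s) := by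
  rw [hf.volume_image hs]
  calc _ = ∫⁻ x in s, ENNReal.ofReal c := by simp
    _ ≤ _ := lintegral_mono fun x => ENNReal.ofReal_le_ofReal (hc x)

theorem volume_image_pos (hf : IsCircleDiffeoLift f) {s : Set ℝ} (hs : MeasurableSet s)
    (h : 0 < volume s) : 0 < volume (f '' s) := by
  obtain ⟨c, hc0, hc⟩ := hf.exists_pos_le_deriv
  exact (ENNReal.mul_pos (ENNReal.ofReal_pos.mpr hc0).ne' h.ne').trans_le (hf.le_volume_image hs hc)

end IsCircleDiffeoLift

/-- The ratio set of the circle diffeomorphism induced by `f`, described through periodic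
subsets of the line. -/
def liftRatioSet (f : ℝ → ℝ) : Set ℝ :=
  {t : ℝ | 0 ≤ t ∧ ∀ A : Set ℝ, MeasurableSet A → (∀ x, x + 1 ∈ A ↔ x ∈ A) → 0 < volume A →
    ∀ ε : ℝ, 0 < ε → ∃ i : ℤ,
      0 < volume {x | x ∈ A ∧ zpowLift f i x ∈ A ∧ |deriv (zpowLift f i) x - t| < ε}}

theorem volume_preimage_coe_pos_iff {S : Set UnitAddCircle} (hS : MeasurableSet S) :
    0 < volume (((↑) : ℝ → UnitAddCircle) ⁻¹' S) ↔ 0 < volume S := by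
  have h : ∀ a : ℝ, volume S = volume (((↑) : ℝ → UnitAddCircle) ⁻¹' S ∩ Set.Ioc a (a + 1)) := by
    intro a
    rw [← (UnitAddCircle.measurePreserving_mk a).measure_preimage hS.nullMeasurableSet,
      Measure.restrict_apply (AddCircle.measurable_mk' hS)]
  constructor
  · intro hp
    by_contra h0
    have h0 : volume S = 0 := by simpa using h0
    refine hp.ne' ?_
    have : ((↑) : ℝ → UnitAddCircle) ⁻¹' S =
        ⋃ n : ℤ, ((↑) : ℝ → UnitAddCircle) ⁻¹' S ∩ Set.Ioc (n : ℝ) (n + 1) := by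
      rw [← Set.inter_iUnion, iUnion_Ioc_intCast, Set.inter_univ]
    rw [this]
    exact measure_iUnion_null fun n => by rw [← h, h0]
  · intro hp
    rw [h 0] at hp
    exact hp.trans_le (measure_mono Set.inter_subset_left)

theorem exists_measurableSet_preimage_coe_eq {A : Set ℝ} (hA : MeasurableSet A)
    (hp : ∀ x, x + 1 ∈ A ↔ x ∈ A) :
    ∃ S : Set UnitAddCircle, MeasurableSet S ∧ ((↑) : ℝ → UnitAddCircle) ⁻¹' S = A := by
  have : Fact (0 < (1 : ℝ)) := ⟨one_pos⟩
  refine ⟨{y | ((AddCircle.measurableEquivIoc (1 : ℝ) 0 y : ℝ)) ∈ A},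
    measurable_subtype_coe.comp (AddCircle.measurableEquivIoc (1 : ℝ) 0).measurable hA, ?_⟩
  ext x
  have hz : ∀ (n : ℤ) (y : ℝ), y + n ∈ A ↔ y ∈ A := by
    intro n y
    have h : Function.Periodic (fun x => x ∈ A) 1 := fun x => propext (hp x)
    simpa using (h.int_mul n y).to_iff
  have h : (((AddCircle.measurableEquivIoc (1 : ℝ) 0 (x : UnitAddCircle) : ℝ)) : UnitAddCircle) = x :=
    (AddCircle.equivIoc (1 : ℝ) 0).symm_apply_apply _
  rw [← sub_eq_zero, ← AddCircle.coe_sub, AddCircle.coe_eq_zero_iff] at h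
  obtain ⟨n, hn⟩ := h
  rw [zsmul_one] at hn
  rw [← hz n x, hn]
  simp

theorem ratioSet_eq_liftRatioSet {f : ℝ → ℝ} (hf : IsCircleDiffeoLift f)
    {Fz : ℤ → UnitAddCircle → UnitAddCircle} {D : ℤ → UnitAddCircle → ℝ}
    (hFz : ∀ i : ℤ, ∀ x : ℝ, Fz i ↑x = ↑(zpowLift f i x))
    (hD : ∀ i : ℤ, ∀ x : ℝ, D i ↑x = deriv (zpowLift f i) x) :
    ratioSet Fz D = liftRatioSet f := by
  have hFc : ∀ i, Continuous (Fz i) := fun i => by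
    refine continuous_coinduced_dom.mpr ?_
    have : Fz i ∘ ((↑) : ℝ → UnitAddCircle) = fun x => ((zpowLift f i x : ℝ) : UnitAddCircle) :=
      funext (hFz i)
    exact this ▸ (AddCircle.continuous_mk' _).comp (hf.zpowLift i).continuous
  have hDc : ∀ i, Continuous (D i) := fun i => by
    refine continuous_coinduced_dom.mpr ?_
    have : D i ∘ ((↑) : ℝ → UnitAddCircle) = deriv (zpowLift f i) := funext (hD i)
    exact this ▸ (hf.zpowLift i).continuous_deriv
  ext t
  refine and_congr_right fun _ => ⟨fun h A hA hp hpos ε hε => ?_, fun h A hA hpos ε hε => ?_⟩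
  · obtain ⟨S, hS, rfl⟩ := exists_measurableSet_preimage_coe_eq hA hp
    obtain ⟨B, hB, hBS, hB0, i, hi, hiB⟩ := h S hS ((volume_preimage_coe_pos_iff hS).mp hpos) ε hε
    refine ⟨i, ((volume_preimage_coe_pos_iff hB).mpr hB0).trans_le (measure_mono fun x hx => ?_)⟩
    refine ⟨hBS hx, ?_, ?_⟩
    · rw [Set.mem_preimage, ← hFz]; exact hi ⟨_, hx, rfl⟩
    · rw [← hD]; exact hiB _ hx
  · obtain ⟨i, hi⟩ := h (((↑) : ℝ → UnitAddCircle) ⁻¹' A) (AddCircle.measurable_mk' hA)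
      (fun x => by simp) ((volume_preimage_coe_pos_iff hA).mpr hpos) ε hε
    have hm : MeasurableSet {y | y ∈ A ∧ Fz i y ∈ A ∧ |D i y - t| < ε} :=
      hA.inter (((hFc i).measurable hA).inter
        (measurableSet_lt ((hDc i).sub continuous_const).abs.measurable measurable_const))
    refine ⟨{y | y ∈ A ∧ Fz i y ∈ A ∧ |D i y - t| < ε}, hm, fun y hy => hy.1, ?_, i, ?_,
      fun y hy => hy.2.2⟩
    · rw [← volume_preimage_coe_pos_iff hm]
      simpa only [Set.preimage_ofPred_eq, hFz, hD, Set.mem_preimage] using hi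
    · rintro _ ⟨y, hy, rfl⟩
      exact hy.2.1

theorem exists_circle_iterates {f : ℝ → ℝ} (hf : IsCircleDiffeoLift f) :
    ∃ Fz : ℤ → UnitAddCircle → UnitAddCircle, ∃ D : ℤ → UnitAddCircle → ℝ,
      (∀ i : ℤ, ∀ x : ℝ, Fz i ↑x = ↑(zpowLift f i x)) ∧
      ∀ i : ℤ, ∀ x : ℝ, D i ↑x = deriv (zpowLift f i) x :=
  ⟨fun i => Function.Periodic.lift (f := fun x => ((zpowLift f i x : ℝ) : UnitAddCircle)) (c := 1)
      fun x => by simp only [(hf.zpowLift i).2.1, AddCircle.coe_add, AddCircle.coe_period, add_zero],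
    fun i => (hf.zpowLift i).deriv_periodic.lift, fun _ _ => rfl, fun _ _ => rfl⟩

namespace IsCircleDiffeoLift

variable {f : ℝ → ℝ}

theorem measurableSet_return (hf : IsCircleDiffeoLift f) {A : Set ℝ} (hA : MeasurableSet A)
    (i : ℤ) (t ε : ℝ) :
    MeasurableSet {x | x ∈ A ∧ _root_.zpowLift f i x ∈ A ∧
      |deriv (_root_.zpowLift f i) x - t| < ε} :=
  hA.inter (((hf.zpowLift i).continuous.measurable hA).inter
    (measurableSet_lt ((hf.zpowLift i).continuous_deriv.sub continuous_const).abs.measurable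
      measurable_const))

theorem deriv_zpowLift_neg (hf : IsCircleDiffeoLift f) (i : ℤ) (x : ℝ) :
    deriv (_root_.zpowLift f (-i)) (_root_.zpowLift f i x) = (deriv (_root_.zpowLift f i) x)⁻¹ := by
  have h := (hf.zpowLift (-i)).deriv_comp (hf.zpowLift i) x
  simp only [hf.zpowLift_neg_apply, deriv_id''] at h
  exact eq_inv_of_mul_eq_one_left h.symm

theorem image_zpowLift (hf : IsCircleDiffeoLift f) (i : ℤ) (s : Set ℝ) :
    _root_.zpowLift f i '' s = _root_.zpowLift f (-i) ⁻¹' s :=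
  congrFun (Set.image_eq_preimage_of_inverse (hf.zpowLift_neg_apply i) (hf.zpowLift_apply_neg i)) s

theorem measurableSet_image_zpowLift (hf : IsCircleDiffeoLift f) (i : ℤ) {s : Set ℝ}
    (hs : MeasurableSet s) : MeasurableSet (_root_.zpowLift f i '' s) := by
  rw [hf.image_zpowLift]
  exact (hf.zpowLift _).continuous.measurable hs

theorem inv_mem_liftRatioSet (hf : IsCircleDiffeoLift f) {t : ℝ} (ht0 : 0 < t)
    (ht : t ∈ liftRatioSet f) : t⁻¹ ∈ liftRatioSet f := by
  refine ⟨(inv_pos.mpr ht0).le, fun A hA hp hpos ε hε => ?_⟩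
  obtain ⟨δ, hδ, hδt⟩ := Metric.continuousAt_iff.mp (continuousAt_inv₀ ht0.ne') ε hε
  obtain ⟨i, hi⟩ := ht.2 A hA hp hpos δ hδ
  refine ⟨-i, ((hf.zpowLift i).volume_image_pos (hf.measurableSet_return hA i t δ) hi).trans_le
    (measure_mono ?_)⟩
  rintro _ ⟨x, ⟨hx, hix, hd⟩, rfl⟩
  refine ⟨hix, by rwa [hf.zpowLift_neg_apply], ?_⟩
  rw [hf.deriv_zpowLift_neg]
  exact hδt hd

theorem mul_mem_liftRatioSet (hf : IsCircleDiffeoLift f) {s t : ℝ} (hs : s ∈ liftRatioSet f)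
    (ht : t ∈ liftRatioSet f) : s * t ∈ liftRatioSet f := by
  refine ⟨mul_nonneg hs.1 ht.1, fun A hA hp hpos ε hε => ?_⟩
  obtain ⟨δ, hδ, hδt⟩ := Metric.continuousAt_iff.mp
    ((continuous_fst.mul continuous_snd : Continuous fun p : ℝ × ℝ => p.1 * p.2).continuousAt
      (x := (s, t))) ε hε
  obtain ⟨i, hi⟩ := hs.2 A hA hp hpos δ hδ
  set B := {x | x ∈ A ∧ _root_.zpowLift f i x ∈ A ∧ |deriv (_root_.zpowLift f i) x - s| < δ}
  have hB : MeasurableSet B := hf.measurableSet_return hA i s δ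
  have hBp : ∀ x, x + 1 ∈ B ↔ x ∈ B := fun x => by
    simp only [B, Set.mem_ofPred_eq, (hf.zpowLift i).2.1, hp, (hf.zpowLift i).deriv_periodic x]
  obtain ⟨j, hj⟩ := ht.2 (_root_.zpowLift f i '' B) (hf.measurableSet_image_zpowLift i hB)
    (fun x => by
      rw [hf.image_zpowLift, Set.mem_preimage, Set.mem_preimage, (hf.zpowLift _).2.1, hBp])
    ((hf.zpowLift i).volume_image_pos hB hi) δ hδ
  refine ⟨j + i, ((hf.zpowLift (-i)).volume_image_pos (hf.measurableSet_return
    (hf.measurableSet_image_zpowLift i hB) j t δ) hj).trans_le (measure_mono ?_)⟩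
  rintro _ ⟨_, ⟨⟨x, ⟨hx, hix, hd⟩, rfl⟩, ⟨y, hy, hyx⟩, hd'⟩, rfl⟩
  rw [hf.zpowLift_neg_apply]
  refine ⟨hx, by rw [hf.zpowLift_add, ← hyx]; exact hy.2.1, ?_⟩
  have h := (hf.zpowLift j).deriv_comp (hf.zpowLift i) x
  rw [show (fun x => _root_.zpowLift f j (_root_.zpowLift f i x)) = _root_.zpowLift f (j + i) from
    funext fun x => (hf.zpowLift_add j i x).symm] at h
  rw [h, mul_comm]
  exact hδt (x := (deriv (_root_.zpowLift f i) x, deriv (_root_.zpowLift f j) _))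
    (max_lt hd hd')

theorem zero_mem_liftRatioSet {s : ℝ} (hs0 : 0 ≤ s) (hs1 : s < 1)
    (h : ∀ n : ℕ, s ^ n ∈ liftRatioSet f) : (0 : ℝ) ∈ liftRatioSet f := by
  refine ⟨le_rfl, fun A hA hp hpos ε hε => ?_⟩
  obtain ⟨n, hn⟩ := exists_pow_lt_of_lt_one (half_pos hε) hs1
  obtain ⟨i, hi⟩ := (h n).2 A hA hp hpos (ε / 2) (half_pos hε)
  refine ⟨i, hi.trans_le (measure_mono fun x hx => ⟨hx.1, hx.2.1, ?_⟩)⟩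
  have := hx.2.2
  have h0 := pow_nonneg hs0 n
  rw [abs_lt] at this ⊢
  constructor <;> linarith

theorem zpow_subset_liftRatioSet (hf : IsCircleDiffeoLift f) {s : ℝ} (hs : 1 < s)
    (h : s ∈ liftRatioSet f) : {t : ℝ | ∃ n : ℤ, t = s ^ n} ∪ {0} ⊆ liftRatioSet f := by
  have hs0 : 0 < s := one_pos.trans hs
  have h1 : (1 : ℝ) ∈ liftRatioSet f := by
    rw [← mul_inv_cancel₀ hs0.ne']
    exact hf.mul_mem_liftRatioSet h (hf.inv_mem_liftRatioSet hs0 h)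
  have hpow : ∀ t ∈ liftRatioSet f, ∀ n : ℕ, t ^ n ∈ liftRatioSet f := fun t ht n => by
    induction n with
    | zero => simpa using h1
    | succ n ih => rw [pow_succ]; exact hf.mul_mem_liftRatioSet ih ht
  rintro t (⟨n, rfl⟩ | rfl)
  · obtain ⟨n, rfl | rfl⟩ := n.eq_nat_or_neg
    · simpa using hpow s h n
    · rw [zpow_neg, zpow_natCast, ← inv_pow]
      exact hpow _ (hf.inv_mem_liftRatioSet hs0 h) n
  · exact zero_mem_liftRatioSet (inv_pos.mpr hs0).le (inv_lt_one_of_one_lt₀ hs)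
      (hpow _ (hf.inv_mem_liftRatioSet hs0 h))

end IsCircleDiffeoLift

/-- The conjugate `H ∘ R_a ∘ H⁻¹` of the rotation by `a`. -/
def rotConj (H : ℝ → ℝ) (a : ℝ) : ℝ → ℝ := fun x => H (Function.invFun H x + a)

/-- The lift of `ψ` under the `q`-fold covering of the circle by itself, commuting with
`R_{1/q}`. -/
def coverLift (ψ : ℝ → ℝ) (q : ℕ) : ℝ → ℝ := fun x => ψ (q * x) / q

namespace IsCircleDiffeoLift

variable {H ψ : ℝ → ℝ}

theorem add_const (a : ℝ) : IsCircleDiffeoLift (fun x => x + a) :=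
  ⟨contDiff_id.add contDiff_const, fun x => by ring, fun x => by simp⟩

theorem rotConj (hH : IsCircleDiffeoLift H) (a : ℝ) : IsCircleDiffeoLift (rotConj H a) :=
  hH.comp ((add_const a).comp hH.invFun)

theorem rotConj_rotConj (hH : IsCircleDiffeoLift H) (a b : ℝ) (x : ℝ) :
    _root_.rotConj H a (_root_.rotConj H b x) = _root_.rotConj H (b + a) x := by
  simp only [_root_.rotConj, hH.invFun_apply, add_assoc]

theorem rotConj_zero (hH : IsCircleDiffeoLift H) (x : ℝ) : _root_.rotConj H 0 x = x := by
  simp only [_root_.rotConj, add_zero, hH.apply_invFun]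

theorem iterate_rotConj (hH : IsCircleDiffeoLift H) (a : ℝ) (n : ℕ) :
    (_root_.rotConj H a)^[n] = _root_.rotConj H (n * a) := by
  induction n with
  | zero => ext x; simp [hH.rotConj_zero]
  | succ n ih =>
    ext x
    rw [Function.iterate_succ_apply', ih, hH.rotConj_rotConj]
    push_cast
    ring_nf

theorem deriv_rotConj (hH : IsCircleDiffeoLift H) (a x : ℝ) :
    deriv (_root_.rotConj H a) x =
      deriv H (Function.invFun H x + a) / deriv H (Function.invFun H x) := by
  have h := hH.deriv_comp ((add_const a).comp hH.invFun) x
  rw [show _root_.rotConj H a = fun x => H (Function.invFun H x + a) from rfl, h,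
    deriv_add_const, hH.deriv_invFun, div_eq_mul_inv]

theorem abs_rotConj_zero_sub_le (hH : IsCircleDiffeoLift H) (a : ℝ) :
    |_root_.rotConj H a 0 - a| ≤ 1 := by
  set y := Function.invFun H 0
  have hy : H y = 0 := hH.apply_invFun 0
  have h1 := hH.map_add_int y ⌊a⌋
  have h2 := hH.map_add_int y (⌊a⌋ + 1)
  push_cast at h2
  have h3 : H (y + ⌊a⌋) ≤ H (y + a) := hH.strictMono.monotone (by linarith [Int.floor_le a])
  have h4 : H (y + a) < H (y + (⌊a⌋ + 1)) := hH.strictMono (by linarith [Int.lt_floor_add_one a])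
  have := Int.floor_le a
  have := Int.lt_floor_add_one a
  change |H (y + a) - a| ≤ 1
  rw [abs_le]
  constructor <;> linarith

theorem coverLift (hψ : IsCircleDiffeoLift ψ) {q : ℕ} (hq : 0 < q) :
    IsCircleDiffeoLift (coverLift ψ q) := by
  have hq' : (0 : ℝ) < q := Nat.cast_pos.mpr hq
  refine ⟨(hψ.1.comp (contDiff_const.mul contDiff_id)).div_const _, fun x => ?_, fun x => ?_⟩
  · have := hψ.map_add_int (q * x) q
    simp only [_root_.coverLift, mul_add, mul_one]
    push_cast at this
    rw [this, add_div, div_self hq'.ne']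
  · have h : HasDerivAt (_root_.coverLift ψ q) _ x :=
      ((hψ.hasDerivAt (q * x)).comp x ((hasDerivAt_id x).const_mul (q : ℝ))).div_const (q : ℝ)
    rw [h.deriv]
    have := hψ.2.2 (q * x)
    positivity

theorem deriv_coverLift (hψ : IsCircleDiffeoLift ψ) {q : ℕ} (hq : 0 < q) (x : ℝ) :
    deriv (_root_.coverLift ψ q) x = deriv ψ (q * x) := by
  have h : HasDerivAt (_root_.coverLift ψ q) _ x :=
    ((hψ.hasDerivAt (q * x)).comp x ((hasDerivAt_id x).const_mul (q : ℝ))).div_const (q : ℝ)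
  rw [h.deriv]
  have : (q : ℝ) ≠ 0 := by positivity
  field_simp

theorem coverLift_add_div (hψ : IsCircleDiffeoLift ψ) {q : ℕ} (hq : 0 < q) (x : ℝ) (p : ℤ) :
    _root_.coverLift ψ q (x + p / q) = _root_.coverLift ψ q x + p / q := by
  have hq' : (q : ℝ) ≠ 0 := by positivity
  simp only [_root_.coverLift]
  rw [show (q : ℝ) * (x + p / q) = q * x + p by field_simp, hψ.map_add_int, add_div]

theorem invFun_coverLift (hψ : IsCircleDiffeoLift ψ) {q : ℕ} (hq : 0 < q) :
    Function.invFun (_root_.coverLift ψ q) = _root_.coverLift (Function.invFun ψ) q := by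
  have hq' : (q : ℝ) ≠ 0 := by positivity
  refine (hψ.coverLift hq).invFun_eq_of_leftInverse fun x => ?_
  simp only [_root_.coverLift]
  rw [mul_div_cancel₀ _ hq', hψ.apply_invFun, mul_div_cancel_left₀ _ hq']

theorem invFun_comp {A : ℝ → ℝ} (hH : IsCircleDiffeoLift H) (hA : IsCircleDiffeoLift A) :
    Function.invFun (fun x => H (A x)) = fun x => Function.invFun A (Function.invFun H x) :=
  (hH.comp hA).invFun_eq_of_leftInverse fun x => by rw [hA.apply_invFun, hH.apply_invFun]

theorem iteratedDeriv_periodic (hH : IsCircleDiffeoLift H) {i : ℕ} (hi : 1 ≤ i) :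
    Function.Periodic (iteratedDeriv i H) 1 := fun x => by
  rw [← congrFun (iteratedDeriv_comp_add_const i H 1) x]
  have : (fun x => H (x + 1)) = fun x => 1 + H x := funext fun x => by rw [hH.2.1, add_comm]
  rw [this, iteratedDeriv_const_add hi]

theorem exists_abs_iteratedDeriv_le (hH : IsCircleDiffeoLift H) {i : ℕ} (hi : 1 ≤ i) :
    ∃ C, ∀ x, |iteratedDeriv i H x| ≤ C :=
  (hH.iteratedDeriv_periodic hi).exists_abs_le
    (hH.1.continuous_iteratedDeriv i (by exact_mod_cast le_top))

end IsCircleDiffeoLift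

/-- A bound for the derivatives of a composition, from bounds for those of its factors. -/
theorem abs_iteratedDeriv_comp_le {g f : ℝ → ℝ} (hg : ContDiff ℝ (⊤ : ℕ∞) g)
    (hf : ContDiff ℝ (⊤ : ℕ∞) f) {n : ℕ} {x C D : ℝ}
    (hC : ∀ i ≤ n, |iteratedDeriv i g (f x)| ≤ C) (hD1 : 1 ≤ D)
    (hD : ∀ i, 1 ≤ i → i ≤ n → |iteratedDeriv i f x| ≤ D) :
    |iteratedDeriv n (fun x => g (f x)) x| ≤ n.factorial * C * D ^ n := by
  have := norm_iteratedFDeriv_comp_le hg hf (n := n) (by exact_mod_cast le_top) x (C := C) (D := D)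
    (fun i hi => by simpa [norm_iteratedFDeriv_eq_norm_iteratedDeriv] using hC i hi)
    (fun i h1 hi => by
      simpa [norm_iteratedFDeriv_eq_norm_iteratedDeriv] using
        (hD i h1 hi).trans (le_self_pow₀ hD1 (by omega)))
  simpa [norm_iteratedFDeriv_eq_norm_iteratedDeriv, Function.comp_def] using this

/-- Families of smooth functions whose derivatives of positive order grow at most polynomially
in the parameter. -/
def PolyBounded (K : ℕ → ℝ → ℝ) : Prop :=
  ∀ i, 1 ≤ i → ∃ C : ℝ, ∃ N : ℕ, ∀ q : ℕ, 1 ≤ q → ∀ x, |iteratedDeriv i (K q) x| ≤ C * q ^ N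

namespace PolyBounded

variable {K L : ℕ → ℝ → ℝ}

theorem uniform (hK : PolyBounded K) (r : ℕ) : ∃ C : ℝ, 1 ≤ C ∧ ∃ N : ℕ, ∀ i, 1 ≤ i → i ≤ r →
    ∀ q : ℕ, 1 ≤ q → ∀ x, |iteratedDeriv i (K q) x| ≤ C * q ^ N := by
  induction r with
  | zero => exact ⟨1, le_rfl, 0, fun i h1 h0 => by omega⟩
  | succ r ih =>
    obtain ⟨C, hC1, N, h⟩ := ih
    obtain ⟨C', N', h'⟩ := hK (r + 1) (by omega)
    refine ⟨max C C', hC1.trans (le_max_left _ _), max N N', fun i h1 hi q hq x => ?_⟩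
    have hq' : (1 : ℝ) ≤ q := by exact_mod_cast hq
    have h0 : 0 ≤ max C C' := zero_le_one.trans (hC1.trans (le_max_left _ _))
    rcases hi.lt_or_eq with hi | rfl
    · refine (h i h1 (by omega) q hq x).trans ?_
      exact mul_le_mul (le_max_left _ _) (pow_le_pow_right₀ hq' (le_max_left _ _)) (by positivity) h0
    · refine (h' q hq x).trans ?_
      exact mul_le_mul (le_max_right _ _) (pow_le_pow_right₀ hq' (le_max_right _ _))
        (by positivity) h0

theorem const {H : ℝ → ℝ} (hH : IsCircleDiffeoLift H) : PolyBounded fun _ => H := fun i hi => by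
  obtain ⟨C, hC⟩ := hH.exists_abs_iteratedDeriv_le hi
  exact ⟨C, 0, fun q _ x => by simpa using hC x⟩

theorem coverLift {ψ : ℝ → ℝ} (hψ : IsCircleDiffeoLift ψ) : PolyBounded (coverLift ψ) := by
  intro i hi
  obtain ⟨C, hC⟩ := hψ.exists_abs_iteratedDeriv_le hi
  refine ⟨C, i, fun q hq x => ?_⟩
  have hq' : (1 : ℝ) ≤ q := by exact_mod_cast hq
  have h : iteratedDeriv i (_root_.coverLift ψ q) x = q ^ i * iteratedDeriv i ψ (q * x) / q := by
    change iteratedDeriv i (fun x => ψ (q * x) / q) x = _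
    rw [iteratedDeriv_div_const, iteratedDeriv_comp_const_mul
      (hψ.1.of_le (by exact_mod_cast le_top))]
  rw [h, abs_div, abs_mul, abs_of_nonneg (by positivity : (0 : ℝ) ≤ (q : ℝ) ^ i),
    abs_of_nonneg (by positivity : (0 : ℝ) ≤ (q : ℝ)), mul_comm C]
  refine (div_le_self (by positivity) hq').trans ?_
  exact mul_le_mul_of_nonneg_left (hC _) (by positivity)

theorem comp (hK : PolyBounded K) (hL : PolyBounded L)
    (hKs : ∀ q, 1 ≤ q → ContDiff ℝ (⊤ : ℕ∞) (K q)) (hLs : ∀ q, 1 ≤ q → ContDiff ℝ (⊤ : ℕ∞) (L q)) :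
    PolyBounded fun q x => K q (L q x) := by
  intro i hi
  obtain ⟨C, hC1, N, hC⟩ := hK.uniform i
  obtain ⟨D, hD1, M, hD⟩ := hL.uniform i
  refine ⟨i.factorial * C * D ^ i, N + M * i, fun q hq x => ?_⟩
  have hq' : (1 : ℝ) ≤ q := by exact_mod_cast hq
  have h0 : (0 : ℝ) ≤ C * q ^ N := by positivity
  have key := abs_iteratedDeriv_comp_le (g := fun y => -K q (L q x) + K q y) (f := L q) (n := i)
    (x := x) (C := C * q ^ N) (D := D * q ^ M) (contDiff_const.add (hKs q hq)) (hLs q hq)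
    (fun j hj => by
      rcases Nat.eq_zero_or_pos j with rfl | hj0
      · simpa using h0
      · rw [iteratedDeriv_const_add hj0]; exact hC j hj0 hj q hq _)
    (one_le_mul_of_one_le_of_one_le hD1 (one_le_pow₀ hq'))
    (fun j h1 hj => hD j h1 hj q hq _)
  rw [iteratedDeriv_const_add hi] at key
  refine key.trans (le_of_eq ?_)
  rw [mul_pow, pow_add, pow_mul]
  ring

/-- Conjugating two rotations that differ by `t` by the members of a polynomially bounded family
gives diffeomorphisms whose `C^r` distance is polynomially bounded times `t`. -/
theorem exists_conj_sub_le (hK : PolyBounded K) (hL : PolyBounded L)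
    (hKs : ∀ q, 1 ≤ q → ContDiff ℝ (⊤ : ℕ∞) (K q)) (hLs : ∀ q, 1 ≤ q → ContDiff ℝ (⊤ : ℕ∞) (L q))
    (r : ℕ) : ∃ C : ℝ, ∃ N : ℕ, 0 ≤ C ∧ ∀ q : ℕ, 1 ≤ q → ∀ i ≤ r, ∀ b t x : ℝ,
      |iteratedDeriv i (fun x => K q (L q x + (b + t)) - K q (L q x + b)) x| ≤ C * q ^ N * |t| := by
  obtain ⟨C, hC1, N, hC⟩ := hK.uniform (r + 1)
  obtain ⟨D, hD1, M, hD⟩ := hL.uniform r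
  refine ⟨r.factorial * C * D ^ r, N + M * r, by positivity, fun q hq i hi b t x => ?_⟩
  have hq' : (1 : ℝ) ≤ q := by exact_mod_cast hq
  have hDq : 1 ≤ D * (q : ℝ) ^ M := one_le_mul_of_one_le_of_one_le hD1 (one_le_pow₀ hq')
  have hs : ∀ c : ℝ, ContDiff ℝ (⊤ : ℕ∞) fun z => K q (z + c) := fun c =>
    (hKs q hq).comp (contDiff_id.add contDiff_const)
  have key := abs_iteratedDeriv_comp_le (g := fun z => K q (z + (b + t)) - K q (z + b)) (f := L q)
    (n := i) (x := x) (C := C * q ^ N * |t|) (D := D * q ^ M) ((hs _).sub (hs _)) (hLs q hq)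
    (fun j hj => by
      have hle : ((j : ℕ∞) : WithTop ℕ∞) ≤ ((⊤ : ℕ∞) : WithTop ℕ∞) := by exact_mod_cast le_top
      have hd : DifferentiableOn ℝ (iteratedDeriv j (K q)) Set.univ :=
        ((hKs q hq).differentiable_iteratedDeriv j
          (by exact_mod_cast WithTop.coe_lt_top j)).differentiableOn
      have hmv := Convex.norm_image_sub_le_of_norm_deriv_le (s := Set.univ)
        (f := iteratedDeriv j (K q)) (C := C * q ^ N) (x := L q x + b) (y := L q x + (b + t))
        (fun y _ => (hd y trivial).differentiableAt Filter.univ_mem)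
        (fun y _ => by rw [← iteratedDeriv_succ]; exact hC (j + 1) (by omega) (by omega) q hq y)
        convex_univ trivial trivial
      have he : iteratedDeriv j (fun z => K q (z + (b + t)) - K q (z + b)) (L q x) =
          iteratedDeriv j (K q) (L q x + (b + t)) - iteratedDeriv j (K q) (L q x + b) := by
        rw [← congrFun (iteratedDeriv_comp_add_const j (K q) (b + t)) (L q x),
          ← congrFun (iteratedDeriv_comp_add_const j (K q) b) (L q x)]
        exact iteratedDeriv_sub ((hs _).contDiffAt.of_le hle) ((hs _).contDiffAt.of_le hle)
      rw [he]
      simpa [add_sub_add_left_eq_sub] using hmv)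
    hDq (fun j h1 hj => hD j h1 (hj.trans hi) q hq _)
  refine key.trans ?_
  have e : (r.factorial : ℝ) * C * D ^ r * q ^ (N + M * r) * |t|
      = r.factorial * (C * q ^ N * |t|) * (D * q ^ M) ^ r := by
    rw [mul_pow, pow_add, pow_mul]; ring
  rw [e]
  have h1 : (i.factorial : ℝ) ≤ r.factorial := by exact_mod_cast Nat.factorial_le hi
  gcongr

end PolyBounded

/-- Refining the conjugacy `H` by `coverLift ψ q` changes the conjugate of `R_a` by an amount that
is polynomially bounded in `q` times the distance of `a` to a fraction with denominator `q`. -/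
theorem exists_rotConj_comp_coverLift_sub_le {H ψ : ℝ → ℝ} (hH : IsCircleDiffeoLift H)
    (hψ : IsCircleDiffeoLift ψ) (r : ℕ) : ∃ C : ℝ, ∃ N : ℕ, 0 ≤ C ∧ ∀ q : ℕ, 1 ≤ q → ∀ p : ℤ,
      ∀ i ≤ r, ∀ a x : ℝ,
      |iteratedDeriv i (fun x => rotConj (fun x => H (coverLift ψ q x)) a x - rotConj H a x) x| ≤
        C * q ^ N * |a - p / q| := by
  obtain ⟨C, N, hC0, hC⟩ := PolyBounded.exists_conj_sub_le
    (K := fun q x => H (coverLift ψ q x))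
    (L := fun q x => coverLift (Function.invFun ψ) q (Function.invFun H x))
    ((PolyBounded.const hH).comp (PolyBounded.coverLift hψ) (fun _ _ => hH.1)
      fun q hq => (hψ.coverLift hq).1)
    ((PolyBounded.coverLift hψ.invFun).comp (PolyBounded.const hH.invFun)
      (fun q hq => (hψ.invFun.coverLift hq).1) fun _ _ => hH.invFun.1)
    (fun q hq => (hH.comp (hψ.coverLift hq)).1)
    (fun q hq => ((hψ.invFun.coverLift hq).comp hH.invFun).1) r
  obtain ⟨C', N', hC0', hC'⟩ := PolyBounded.exists_conj_sub_le
    (PolyBounded.const hH) (PolyBounded.const hH.invFun) (fun _ _ => hH.1)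
    (fun _ _ => hH.invFun.1) r
  refine ⟨C + C', max N N', by positivity, fun q hq p i hi a x => ?_⟩
  have hq' : (1 : ℝ) ≤ q := by exact_mod_cast hq
  have hA := hψ.coverLift hq
  set b : ℝ := p / q with hb
  have ha : a = b + (a - b) := by ring
  have hfun : (fun x => rotConj (fun x => H (coverLift ψ q x)) a x - rotConj H a x) =
      (fun x => H (coverLift ψ q (coverLift (Function.invFun ψ) q (Function.invFun H x)
          + (b + (a - b)))) -
        H (coverLift ψ q (coverLift (Function.invFun ψ) q (Function.invFun H x) + b))) -
      fun x => H (Function.invFun H x + (b + (a - b))) - H (Function.invFun H x + b) := by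
    ext x
    simp only [rotConj, Pi.sub_apply, ← ha, hH.invFun_comp hA, hψ.invFun_coverLift hq]
    rw [hb, hψ.coverLift_add_div hq, ← hψ.invFun_coverLift hq, hA.apply_invFun]
    ring
  have hs : ∀ {K L : ℝ → ℝ}, IsCircleDiffeoLift K → IsCircleDiffeoLift L → ∀ b t : ℝ,
      ContDiff ℝ i fun x => K (L x + (b + t)) - K (L x + b) := fun hK hL b t =>
    ((hK.1.comp (hL.1.add contDiff_const)).sub
      (hK.1.comp (hL.1.add contDiff_const))).of_le (by exact_mod_cast le_top)
  rw [hfun, iteratedDeriv_sub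
    (hs (hH.comp hA) ((hψ.invFun.coverLift hq).comp hH.invFun) _ _).contDiffAt
    (hs hH hH.invFun _ _).contDiffAt]
  refine (abs_sub _ _).trans ((add_le_add (hC q hq i hi _ _ _) (hC' q hq i hi _ _ _)).trans ?_)
  rw [add_mul, add_mul]
  gcongr
  · exact le_max_left _ _
  · exact le_max_right _ _

/-- A smooth 1-periodic function, equal to `0` where `sin (2πx) ≤ 0` and to `1` where
`sin (2πx) ≥ 1/N`. -/
def smoothWave (N x : ℝ) : ℝ := Real.smoothTransition (N * Real.sin (2 * Real.pi * x))

theorem smoothWave_contDiff (N : ℝ) : ContDiff ℝ (⊤ : ℕ∞) (smoothWave N) :=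
  Real.smoothTransition.contDiff.comp
    (contDiff_const.mul (Real.contDiff_sin.comp (contDiff_const.mul contDiff_id)))

theorem sin_two_pi_mul_sub_int (x : ℝ) (k : ℤ) :
    Real.sin (2 * Real.pi * (x - k)) = Real.sin (2 * Real.pi * x) := by
  rw [show 2 * Real.pi * (x - k) = 2 * Real.pi * x - k * (2 * Real.pi) by ring,
    Real.sin_sub_int_mul_two_pi]

theorem smoothWave_periodic (N : ℝ) : Function.Periodic (smoothWave N) 1 := fun x => by
  simp only [smoothWave]
  rw [← sin_two_pi_mul_sub_int (x + 1) 1]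
  simp

theorem smoothWave_eq_zero {N : ℝ} (hN : 0 ≤ N) {x : ℝ} (k : ℤ) (h1 : k + 1 / 2 ≤ x)
    (h2 : x ≤ k + 1) : smoothWave N x = 0 := by
  refine Real.smoothTransition.zero_of_nonpos (mul_nonpos_of_nonneg_of_nonpos hN ?_)
  rw [← sin_two_pi_mul_sub_int x (k + 1)]
  have := Real.pi_pos
  push_cast
  exact Real.sin_nonpos_of_nonpos_of_neg_pi_le (by nlinarith) (by nlinarith)

theorem smoothWave_eq_one {N : ℝ} (hN : 6 ≤ N) {x : ℝ} (k : ℤ) (h1 : k + 1 / 24 ≤ x)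
    (h2 : x ≤ k + 11 / 24) : smoothWave N x = 1 := by
  refine Real.smoothTransition.one_of_one_le ?_
  rw [← sin_two_pi_mul_sub_int x k]
  have hpi := Real.pi_pos
  have h6 : 1 / 6 ≤ Real.sin (2 * Real.pi * (x - k)) := by
    have key : ∀ y : ℝ, 1 / 24 ≤ y → y ≤ 1 / 4 → 1 / 6 ≤ Real.sin (2 * Real.pi * y) := by
      intro y hy1 hy2
      have := Real.mul_le_sin (x := 2 * Real.pi * y) (by positivity) (by nlinarith)
      rw [show 2 / Real.pi * (2 * Real.pi * y) = 4 * y by field_simp; ring] at this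
      linarith
    rcases le_total (x - k) (1 / 4) with h | h
    · exact key _ (by linarith) h
    · rw [← Real.sin_pi_sub, show Real.pi - 2 * Real.pi * (x - k) = 2 * Real.pi * (1 / 2 - (x - k))
        by ring]
      exact key _ (by linarith) (by linarith)
  nlinarith

/-- A diffeomorphism whose derivative interpolates between the slopes `1/c` and `lam/c` along
`smoothWave N`, where `c` is the normalising constant. -/
theorem exists_deriv_eq_smoothWave {lam : ℝ} (hlam : 1 < lam) (N : ℝ) :
    ∃ ψ : ℝ → ℝ, ∃ c : ℝ, IsCircleDiffeoLift ψ ∧ ψ 0 = 0 ∧ 1 ≤ c ∧ c ≤ lam ∧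
      ∀ x, deriv ψ x = (1 + (lam - 1) * smoothWave N x) / c := by
  have hcont := (smoothWave_contDiff N).continuous
  have hI : ∀ a b, IntervalIntegrable (smoothWave N) volume a b := fun a b =>
    hcont.intervalIntegrable a b
  have h0 : ∀ x, 0 ≤ smoothWave N x := fun x => Real.smoothTransition.nonneg _
  have h1 : ∀ x, smoothWave N x ≤ 1 := fun x => Real.smoothTransition.le_one _
  set W : ℝ → ℝ := fun x => ∫ t in (0 : ℝ)..x, smoothWave N t with hW
  have hWd : ∀ x, HasDerivAt W (smoothWave N x) x := fun x =>
    hcont.integral_hasStrictDerivAt 0 x |>.hasDerivAt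
  have hWs : ContDiff ℝ (⊤ : ℕ∞) W := by
    rw [contDiff_infty_iff_deriv]
    refine ⟨fun x => (hWd x).differentiableAt, ?_⟩
    rw [funext fun x => (hWd x).deriv]
    exact smoothWave_contDiff N
  have hW1 : ∀ x, W (x + 1) = W x + W 1 := fun x => by
    have := (smoothWave_periodic N).intervalIntegral_add_eq_add 0 x fun a b => hI a b
    simpa [hW] using this
  have hW0 : 0 ≤ W 1 := intervalIntegral.integral_nonneg zero_le_one fun x _ => h0 x
  have hW1' : W 1 ≤ 1 := by
    have := intervalIntegral.integral_mono_on (a := (0 : ℝ)) (b := 1) zero_le_one (hI 0 1)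
      (intervalIntegrable_const (c := (1 : ℝ))) fun x _ => h1 x
    simpa using this
  set c := 1 + (lam - 1) * W 1 with hc
  have hc1 : 1 ≤ c := by nlinarith
  have hd : ∀ x, HasDerivAt (fun x => (x + (lam - 1) * W x) / c)
      ((1 + (lam - 1) * smoothWave N x) / c) x := fun x =>
    ((hasDerivAt_id x).add ((hWd x).const_mul (lam - 1))).div_const c
  refine ⟨fun x => (x + (lam - 1) * W x) / c, c, ⟨?_, fun x => ?_, fun x => ?_⟩, by simp [hW], hc1,
    by nlinarith, fun x => (hd x).deriv⟩
  · exact (contDiff_id.add (contDiff_const.mul hWs)).div_const c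
  · simp only [hW1]
    field_simp
    rw [hc]
    ring
  · rw [(hd x).deriv]
    have := mul_nonneg (sub_pos.mpr hlam).le (h0 x)
    positivity

theorem volume_preimage_mul_inter_Icc {Z : Set ℝ} (hZ : MeasurableSet Z)
    (hp : ∀ x, x + 1 ∈ Z ↔ x ∈ Z) (M : ℕ) {q : ℕ} (hq : 0 < q) :
    volume {y : ℝ | |y| ≤ M ∧ (q : ℝ) * y ∈ Z} =
      ENNReal.ofReal (2 * M) * volume (Z ∩ Set.Ioc 0 1) := by
  set f : ℝ → ℝ := Z.indicator 1 with hf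
  have hfp : Function.Periodic f 1 := fun x => by
    by_cases h : x ∈ Z <;> simp [hf, h, hp]
  have hfi : ∀ a b, IntervalIntegrable f volume a b := fun a b => by
    rw [intervalIntegrable_iff]
    exact (integrableOn_const (by simp)).indicator hZ
  have hvol : ∀ {a b : ℝ}, a ≤ b → ∀ {Y : Set ℝ}, MeasurableSet Y →
      ∫ x in a..b, Y.indicator (1 : ℝ → ℝ) x = volume.real (Y ∩ Set.Ioc a b) := by
    intro a b hab Y hY
    rw [intervalIntegral.integral_of_le hab, integral_indicator_one hY, measureReal_restrict_apply hY]
  have hq' : (q : ℝ) ≠ 0 := by positivity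
  have hmeas : MeasurableSet {y : ℝ | (q : ℝ) * y ∈ Z} := measurable_const_mul (q : ℝ) hZ
  have key : volume.real ({y | (q : ℝ) * y ∈ Z} ∩ Set.Ioc (-(M : ℝ)) M) =
      2 * M * volume.real (Z ∩ Set.Ioc 0 1) := by
    rw [← hvol (by linarith [(Nat.cast_nonneg M : (0 : ℝ) ≤ M)]) hmeas, ← hvol zero_le_one hZ]
    have e1 : ∀ x, ({y | (q : ℝ) * y ∈ Z}).indicator (1 : ℝ → ℝ) x = f (q * x) := fun x => rfl
    simp_rw [e1]
    rw [intervalIntegral.integral_comp_mul_left f hq']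
    have := hfp.intervalIntegral_add_zsmul_eq (2 * q * M : ℤ) (q * -(M : ℝ)) fun a b => hfi a b
    rw [zsmul_eq_mul, mul_one, hfp.intervalIntegral_add_eq (q * -(M : ℝ)) 0, zero_add] at this
    push_cast at this
    rw [show (q : ℝ) * -(M : ℝ) + 2 * q * M = q * M by ring] at this
    rw [this]
    simp only [zsmul_eq_mul, smul_eq_mul]
    push_cast
    field_simp
    rfl
  have hae : volume {y : ℝ | |y| ≤ M ∧ (q : ℝ) * y ∈ Z} =
      volume ({y | (q : ℝ) * y ∈ Z} ∩ Set.Ioc (-(M : ℝ)) M) := by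
    have : {y : ℝ | |y| ≤ M ∧ (q : ℝ) * y ∈ Z} = {y | (q : ℝ) * y ∈ Z} ∩ Set.Icc (-(M : ℝ)) M := by
      ext y; simp [abs_le, and_comm]
    rw [this]
    exact measure_congr (ae_eq_set_inter (ae_eq_refl _) Ioc_ae_eq_Icc.symm)
  have hfin : ∀ (Y : Set ℝ) (a b : ℝ), volume (Y ∩ Set.Ioc a b) ≠ ⊤ := fun Y a b =>
    ((measure_mono Set.inter_subset_right).trans_lt (by simp)).ne
  rw [hae, ← ENNReal.ofReal_toReal (hfin {y | (q : ℝ) * y ∈ Z} _ _),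
    ← ENNReal.ofReal_toReal (hfin Z 0 1), ← ENNReal.ofReal_mul (by positivity)]
  exact congrArg _ key

theorem exists_volume_transition_le (δ : ℝ) (hδ : 0 < δ) : ∃ N : ℝ, 6 ≤ N ∧
    volume ({x | 0 < Real.sin (2 * Real.pi * x) ∧ N * Real.sin (2 * Real.pi * x) < 1} ∩
      Set.Ioc 0 1) ≤ ENNReal.ofReal δ := by
  set B : ℕ → Set ℝ := fun n => {x | 0 < Real.sin (2 * Real.pi * x) ∧
    (n : ℝ) * Real.sin (2 * Real.pi * x) < 1} ∩ Set.Ioc 0 1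
  have hs : Continuous fun x : ℝ => Real.sin (2 * Real.pi * x) :=
    Real.continuous_sin.comp (continuous_const.mul continuous_id)
  have hBm : ∀ n, MeasurableSet (B n) := fun n =>
    ((measurableSet_lt measurable_const hs.measurable).inter
      (measurableSet_lt (hs.measurable.const_mul _) measurable_const)).inter measurableSet_Ioc
  have hanti : Antitone B := fun m n hmn x hx =>
    ⟨⟨hx.1.1, lt_of_le_of_lt (mul_le_mul_of_nonneg_right (by exact_mod_cast hmn) hx.1.1.le)
      hx.1.2⟩, hx.2⟩
  have hempty : ⋂ n, B n = ∅ := by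
    ext x
    simp only [Set.mem_iInter, Set.mem_empty_iff_false, iff_false, not_forall]
    by_cases h : 0 < Real.sin (2 * Real.pi * x)
    · obtain ⟨n, hn⟩ := exists_nat_gt (1 / Real.sin (2 * Real.pi * x))
      refine ⟨n, fun hx => ?_⟩
      rw [div_lt_iff₀ h] at hn
      exact lt_asymm hn hx.1.2
    · exact ⟨0, fun hx => h hx.1.1⟩
  have ht := tendsto_measure_iInter_atTop (μ := volume) (fun n => (hBm n).nullMeasurableSet) hanti
    ⟨0, ((measure_mono Set.inter_subset_right).trans_lt (by simp)).ne⟩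
  rw [hempty, measure_empty] at ht
  obtain ⟨n, hn6, hn⟩ := ((eventually_ge_atTop 6).and
    (ht.eventually_le_const (ENNReal.ofReal_pos.mpr hδ))).exists
  exact ⟨n, by exact_mod_cast hn6, hn⟩

/-- The basic building block: a diffeomorphism with only two slopes `1/c` and `lam/c`, except on
a set that is small, also after rescaling by any `q`. -/
theorem exists_twoSlope {lam : ℝ} (hlam : 1 < lam) (M : ℕ) {δ : ℝ} (hδ : 0 < δ) :
    ∃ ψ : ℝ → ℝ, ∃ c : ℝ, IsCircleDiffeoLift ψ ∧ ψ 0 = 0 ∧ 1 ≤ c ∧ c ≤ lam ∧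
      (∀ x, 1 / c ≤ deriv ψ x ∧ deriv ψ x ≤ lam / c) ∧
      (∀ (k : ℤ) (x : ℝ), k + 1 / 2 ≤ x → x ≤ k + 1 → deriv ψ x = 1 / c) ∧
      (∀ (k : ℤ) (x : ℝ), k + 1 / 24 ≤ x → x ≤ k + 11 / 24 → deriv ψ x = lam / c) ∧
      ∀ q : ℕ, 1 ≤ q →
        volume {y : ℝ | |y| ≤ M ∧ ¬(deriv ψ (q * y) = 1 / c ∨ deriv ψ (q * y) = lam / c)} ≤
        ENNReal.ofReal δ := by
  obtain ⟨N, hN, hvol⟩ := exists_volume_transition_le (δ / (2 * M + 1)) (by positivity)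
  obtain ⟨ψ, c, hψ, hψ0, hc1, hclam, hd⟩ := exists_deriv_eq_smoothWave hlam N
  have hc0 : 0 < c := one_pos.trans_le hc1
  have h0 : ∀ x, 0 ≤ smoothWave N x := fun x => Real.smoothTransition.nonneg _
  have h1 : ∀ x, smoothWave N x ≤ 1 := fun x => Real.smoothTransition.le_one _
  refine ⟨ψ, c, hψ, hψ0, hc1, hclam, fun x => ?_, fun k x hx1 hx2 => ?_, fun k x hx1 hx2 => ?_,
    fun q hq => ?_⟩
  · rw [hd]
    have := h0 x
    have := h1 x
    constructor <;> gcongr <;> nlinarith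
  · rw [hd, smoothWave_eq_zero (by linarith) k hx1 hx2]; ring
  · rw [hd, smoothWave_eq_one hN k hx1 hx2]; ring
  · have hs : Continuous fun x : ℝ => Real.sin (2 * Real.pi * x) :=
      Real.continuous_sin.comp (continuous_const.mul continuous_id)
    set Z := {x | 0 < Real.sin (2 * Real.pi * x) ∧ N * Real.sin (2 * Real.pi * x) < 1}
    have hZ : MeasurableSet Z := (measurableSet_lt measurable_const hs.measurable).inter
      (measurableSet_lt (hs.measurable.const_mul _) measurable_const)
    have hsub : {y : ℝ | |y| ≤ M ∧ ¬(deriv ψ (q * y) = 1 / c ∨ deriv ψ (q * y) = lam / c)} ⊆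
        {y : ℝ | |y| ≤ M ∧ (q : ℝ) * y ∈ Z} := by
      rintro y ⟨hy, hn⟩
      refine ⟨hy, ?_⟩
      by_contra hZy
      apply hn
      rw [hd]
      rcases le_or_gt (Real.sin (2 * Real.pi * (q * y))) 0 with h | h
      · left
        have : smoothWave N (q * y) = 0 := Real.smoothTransition.zero_of_nonpos
          (mul_nonpos_of_nonneg_of_nonpos (by linarith) h)
        rw [this]; ring
      · right
        have : smoothWave N (q * y) = 1 := Real.smoothTransition.one_of_one_le
          (not_lt.mp fun h' => hZy ⟨h, h'⟩)
        rw [this]; ring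
    refine (measure_mono hsub).trans ?_
    rw [volume_preimage_mul_inter_Icc hZ (fun x => ?_) M hq]
    · refine (mul_le_mul_right hvol _).trans ?_
      rw [← ENNReal.ofReal_mul (by positivity)]
      apply ENNReal.ofReal_le_ofReal
      rw [mul_div_assoc', div_le_iff₀ (by positivity)]
      nlinarith
    · have := sin_two_pi_mul_sub_int (x + 1) 1
      simp only [Int.cast_one, add_sub_cancel_right] at this
      change (0 < Real.sin _ ∧ N * Real.sin _ < 1) ↔ (0 < Real.sin _ ∧ N * Real.sin _ < 1)
      rw [this]

/-- The density `H' ∘ H⁻¹`, whose reciprocal is the density of the invariant measure of the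
conjugates `rotConj H a`. -/
def conjDensity (H : ℝ → ℝ) (x : ℝ) : ℝ := deriv H (Function.invFun H x)

namespace IsCircleDiffeoLift

variable {H ψ A : ℝ → ℝ}

theorem conjDensity_pos (hH : IsCircleDiffeoLift H) (x : ℝ) : 0 < conjDensity H x := hH.2.2 _

theorem continuous_conjDensity (hH : IsCircleDiffeoLift H) : Continuous (conjDensity H) :=
  hH.continuous_deriv.comp hH.invFun.continuous

theorem conjDensity_periodic (hH : IsCircleDiffeoLift H) :
    Function.Periodic (conjDensity H) 1 := fun x => by
  simp only [conjDensity, hH.invFun.2.1, hH.deriv_periodic _]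

theorem deriv_rotConj_eq_conjDensity_div (hH : IsCircleDiffeoLift H) (a x : ℝ) :
    deriv (_root_.rotConj H a) x = conjDensity H (_root_.rotConj H a x) / conjDensity H x := by
  rw [hH.deriv_rotConj, conjDensity, conjDensity, _root_.rotConj, hH.invFun_apply]

theorem conjDensity_comp (hH : IsCircleDiffeoLift H) (hA : IsCircleDiffeoLift A) (x : ℝ) :
    conjDensity (fun y => H (A y)) x =
      conjDensity H x * deriv A (Function.invFun (fun y => H (A y)) x) := by
  rw [conjDensity, hH.deriv_comp hA, conjDensity, hH.invFun_comp hA, hA.apply_invFun]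

theorem exists_sub_eq_deriv_mul (hH : IsCircleDiffeoLift H) {w₁ w₂ : ℝ} (h : w₁ < w₂) :
    ∃ ξ, w₁ ≤ ξ ∧ ξ ≤ w₂ ∧ H w₂ - H w₁ = deriv H ξ * (w₂ - w₁) := by
  obtain ⟨ξ, hξ, h'⟩ := exists_deriv_eq_slope H h hH.continuous.continuousOn
    hH.differentiable.differentiableOn
  refine ⟨ξ, hξ.1.le, hξ.2.le, ?_⟩
  rw [h', div_mul_cancel₀ _ (sub_pos.mpr h).ne']

theorem abs_sub_self_le_one (hH : IsCircleDiffeoLift H) (h0 : H 0 = 0) (x : ℝ) :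
    |H x - x| ≤ 1 := by
  have h1 := hH.map_add_int 0 ⌊x⌋
  have h2 := hH.map_add_int 0 (⌊x⌋ + 1)
  rw [zero_add, h0, zero_add] at h1 h2
  have h3 := hH.strictMono.monotone (Int.floor_le x)
  have h4 := hH.strictMono.monotone (Int.lt_floor_add_one x).le
  push_cast at h2
  rw [h1] at h3
  rw [h2] at h4
  rw [abs_le]
  constructor <;> linarith [Int.floor_le x, Int.lt_floor_add_one x]

theorem exists_deriv_sub_le_mul (hH : IsCircleDiffeoLift H) {e : ℝ} (he : 0 < e) :
    ∃ ρ, 0 < ρ ∧ ∀ w w', |w - w'| ≤ ρ → |deriv H w - deriv H w'| ≤ e * deriv H w' := by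
  obtain ⟨m, hm0, hm⟩ := hH.exists_pos_le_deriv
  obtain ⟨ρ, hρ0, hρ⟩ := Metric.uniformContinuous_iff.mp
    (hH.deriv_periodic.uniformContinuous hH.continuous_deriv) (e * m) (by positivity)
  refine ⟨ρ / 2, by positivity, fun w w' h => ?_⟩
  have := hρ (a := w) (b := w') (by rw [Real.dist_eq]; linarith)
  rw [Real.dist_eq] at this
  exact this.le.trans (mul_le_mul_of_nonneg_left (hm w') he.le)

end IsCircleDiffeoLift

/-- Every point lies in a small window `[a, b]`, a definite proportion of which is mapped by
`g^[i] - p` into the window, with derivative close to `lam`; `μ` is a safety margin. -/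
def HasWindows (c lam ε μ : ℝ) (i : ℕ) (p : ℤ) (g : ℝ → ℝ) : Prop :=
  (∀ x, c + μ ≤ deriv g^[i] x) ∧ ∀ x, ∃ a b u v : ℝ, a ≤ x ∧ x ≤ b ∧ a < b ∧ b - a ≤ ε ∧ a ≤ u ∧
    v ≤ b ∧ c * (b - a) ≤ v - u ∧ ∀ z, u ≤ z → z ≤ v →
      a + μ ≤ g^[i] z - p ∧ g^[i] z - p ≤ b - μ ∧ |deriv g^[i] z - lam| + μ ≤ ε

theorem HasWindows.of_close {c lam ε μ : ℝ} {i : ℕ} {p : ℤ} {F g : ℝ → ℝ}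
    (h : HasWindows c lam ε μ i p F) (h0 : ∀ x, |g^[i] x - F^[i] x| ≤ μ)
    (h1 : ∀ x, |deriv g^[i] x - deriv F^[i] x| ≤ μ) : HasWindows c lam ε 0 i p g := by
  refine ⟨fun x => ?_, fun x => ?_⟩
  · linarith [h.1 x, (abs_le.mp (h1 x)).1]
  · obtain ⟨a, b, u, v, hax, hxb, hab, hε, hau, hvb, huv, hz⟩ := h.2 x
    refine ⟨a, b, u, v, hax, hxb, hab, hε, hau, hvb, huv, fun z hz1 hz2 => ?_⟩
    obtain ⟨h2, h3, h4⟩ := hz z hz1 hz2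
    have h5 := abs_le.mp (h0 z)
    refine ⟨by linarith, by linarith, ?_⟩
    have := abs_sub_le (deriv g^[i] z) (deriv F^[i] z) lam
    linarith [h1 z]

theorem exists_iterate_close {F : ℝ → ℝ} (hF : IsCircleDiffeoLift F) (i : ℕ) {μ : ℝ} (hμ : 0 < μ) :
    ∃ η, 0 < η ∧ ∀ g, IsCircleDiffeoLift g →
      (∀ x, |g x - F x| ≤ η ∧ |deriv g x - deriv F x| ≤ η) →
        ∀ x, |g^[i] x - F^[i] x| ≤ μ ∧ |deriv g^[i] x - deriv F^[i] x| ≤ μ := by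
  induction i generalizing μ with
  | zero => exact ⟨1, one_pos, fun g _ _ x => by simp [hμ.le]⟩
  | succ i ih =>
    obtain ⟨K, hK0, hK⟩ := hF.exists_deriv_le
    obtain ⟨L, hL0, hL⟩ := (hF.iterate i).exists_deriv_le
    set e := μ / (2 * (L + 1)) with he
    have he0 : 0 < e := by positivity
    obtain ⟨ρ, hρ0, hρ⟩ := Metric.uniformContinuous_iff.mp
      (hF.deriv_periodic.uniformContinuous hF.continuous_deriv) (e / 2) (by positivity)
    set ν := min 1 (min (ρ / 2) (μ / (2 * K))) with hν
    have hν0 : 0 < ν := by positivity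
    have hν1 : ν ≤ 1 := min_le_left _ _
    have hνρ : ν ≤ ρ / 2 := (min_le_right _ _).trans (min_le_left _ _)
    have hνK : K * ν ≤ μ / 2 := by
      have : ν ≤ μ / (2 * K) := (min_le_right _ _).trans (min_le_right _ _)
      rw [le_div_iff₀ (by positivity)] at this
      linarith
    obtain ⟨η, hη0, hη⟩ := ih hν0
    refine ⟨min η (min (μ / 2) (e / 2)), by positivity, fun g hg hgF x => ?_⟩
    have hgF' := fun x => (hgF x).imp (fun h => h.trans (min_le_left _ _))
      fun h => h.trans (min_le_left _ _)
    obtain ⟨h0, h1⟩ := hη g hg hgF' x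
    obtain ⟨h2, h3⟩ := hgF (g^[i] x)
    have h2' : |g (g^[i] x) - F (g^[i] x)| ≤ μ / 2 :=
      h2.trans ((min_le_right _ _).trans (min_le_left _ _))
    have h3' : |deriv g (g^[i] x) - deriv F (g^[i] x)| ≤ e / 2 :=
      h3.trans ((min_le_right _ _).trans (min_le_right _ _))
    have hK' : ∀ x, ‖deriv F x‖ ≤ K := fun x => by
      rw [Real.norm_of_nonneg (hF.2.2 x).le]; exact hK x
    have h4 : |F (g^[i] x) - F (F^[i] x)| ≤ K * ν := by
      have := convex_univ.norm_image_sub_le_of_norm_deriv_le (f := F)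
        (fun x _ => hF.differentiable x) (fun x _ => hK' x) (Set.mem_univ (F^[i] x))
        (Set.mem_univ (g^[i] x))
      exact this.trans (mul_le_mul_of_nonneg_left h0 hK0.le)
    have h5 : |deriv F (g^[i] x) - deriv F (F^[i] x)| ≤ e / 2 :=
      (hρ (a := g^[i] x) (b := F^[i] x) (by rw [Real.dist_eq]; linarith)).le
    simp only [Function.iterate_succ']
    refine ⟨?_, ?_⟩
    · have := abs_sub_le (g (g^[i] x)) (F (g^[i] x)) (F (F^[i] x))
      simp only [Function.comp]
      linarith
    · have e1 : deriv (g ∘ g^[i]) x = deriv g (g^[i] x) * deriv g^[i] x :=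
        hg.deriv_comp (hg.iterate i) x
      have e2 : deriv (F ∘ F^[i]) x = deriv F (F^[i] x) * deriv F^[i] x :=
        hF.deriv_comp (hF.iterate i) x
      rw [e1, e2]
      have h6 : |deriv g (g^[i] x) - deriv F (F^[i] x)| ≤ e := by
        have := abs_sub_le (deriv g (g^[i] x)) (deriv F (g^[i] x)) (deriv F (F^[i] x))
        linarith
      have h7 : |deriv g^[i] x| ≤ L + 1 := by
        rw [abs_of_pos ((hg.iterate i).2.2 x)]
        linarith [(abs_le.mp h1).2, hL x]
      have h8 : |deriv F (F^[i] x)| ≤ K := hK' _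
      calc _ = |(deriv g (g^[i] x) - deriv F (F^[i] x)) * deriv g^[i] x +
            deriv F (F^[i] x) * (deriv g^[i] x - deriv F^[i] x)| := by ring_nf
        _ ≤ |deriv g (g^[i] x) - deriv F (F^[i] x)| * |deriv g^[i] x| +
            |deriv F (F^[i] x)| * |deriv g^[i] x - deriv F^[i] x| := by
          rw [← abs_mul, ← abs_mul]; exact abs_add_le _ _
        _ ≤ e * (L + 1) + K * ν := by gcongr
        _ ≤ μ := by
          have : e * (L + 1) = μ / 2 := by rw [he]; field_simp
          linarith

theorem Liouville.exists_approx {α : ℝ} (hα : Liouville α) (C : ℝ) (N : ℕ) {ε : ℝ} (hε : 0 < ε)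
    (Q : ℝ) : ∃ q : ℕ, ∃ p : ℤ, 1 ≤ q ∧ Q ≤ q ∧ α ≠ p / q ∧ C * q ^ N * |α - p / q| ≤ ε ∧
      q ^ 2 * |α - p / q| ≤ 1 / 24 := by
  obtain ⟨Q', hQ'⟩ := exists_nat_ge (max Q (max 24 (|C| / ε)))
  obtain ⟨q, hq, p, hne, hlt⟩ := ((hα.frequently_exists_num (N + 3)).and_eventually
    (eventually_ge_atTop Q')).exists.imp fun q h => And.intro h.2 h.1
  have hq1 : max Q (max 24 (|C| / ε)) ≤ q := hQ'.trans (by exact_mod_cast hq)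
  have hqQ : Q ≤ q := (le_max_left _ _).trans hq1
  have hq24 : (24 : ℝ) ≤ q := ((le_max_left _ _).trans (le_max_right _ _)).trans hq1
  have hqC : |C| / ε ≤ q := ((le_max_right _ _).trans (le_max_right _ _)).trans hq1
  have hq0 : (0 : ℝ) < q := by linarith
  rw [div_le_iff₀ hε] at hqC
  have hq1' : (1 : ℝ) ≤ q := by linarith
  refine ⟨q, p, by exact_mod_cast hq1', hqQ, hne, ?_, ?_⟩
  · calc C * q ^ N * |α - p / q| ≤ |C| * q ^ N * (1 / q ^ (N + 3)) := by
          gcongr; exact le_abs_self C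
      _ = |C| / q ^ 3 := by field_simp; ring
      _ ≤ |C| / q := by
          gcongr
          exact le_self_pow₀ hq1' (by norm_num)
      _ ≤ ε := by rw [div_le_iff₀ hq0]; linarith
  · calc (q : ℝ) ^ 2 * |α - p / q| ≤ q ^ 2 * (1 / q ^ (N + 3)) := by gcongr
      _ = 1 / (q : ℝ) ^ (N + 1) := by field_simp; ring
      _ ≤ 1 / 24 := by
          gcongr
          exact hq24.trans (le_self_pow₀ hq1' (by norm_num))

theorem exists_mul_near_half {q : ℕ} (hq : 1 ≤ q) {p : ℤ} {α : ℝ} (hne : α ≠ p / q)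
    (hs : (q : ℝ) ^ 2 * |α - p / q| ≤ 1 / 24) : ∃ (i : ℕ) (p' : ℤ) (τ : ℝ), i * α = τ + p' ∧
      (11 / 24 ≤ q * τ ∧ q * τ ≤ 1 / 2 ∨ -(1 / 2) ≤ q * τ ∧ q * τ ≤ -(11 / 24)) := by
  have hq0 : (0 : ℝ) < q := by exact_mod_cast hq
  set s := q * α - p with hs_def
  have hs' : q * |s| ≤ 1 / 24 := by
    have : s = q * (α - p / q) := by rw [hs_def]; field_simp
    rw [this, abs_mul, abs_of_pos hq0]
    linarith [hs]
  have hs0 : 0 < |s| := abs_pos.mpr fun h => hne (by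
    rw [eq_div_iff hq0.ne']; linarith)
  have hqs : 0 < q * |s| := by positivity
  set j := ⌊1 / (2 * (q * |s|))⌋₊ with hj
  have h1 : j * (q * |s|) ≤ 1 / 2 := by
    have := Nat.floor_le (a := 1 / (2 * (q * |s|))) (by positivity)
    rw [le_div_iff₀ (by positivity)] at this
    linarith
  have h2 : 1 / 2 < j * (q * |s|) + q * |s| := by
    have := Nat.lt_floor_add_one (1 / (2 * (q * |s|)))
    rw [div_lt_iff₀ (by positivity)] at this
    linarith
  refine ⟨q * j, j * p, j * s, ?_, ?_⟩
  · push_cast; rw [hs_def]; ring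
  · rcases lt_or_ge 0 s with h | h
    · left
      rw [abs_of_pos h] at *
      constructor <;> linarith
    · right
      rw [abs_of_nonpos h] at *
      constructor <;> linarith

theorem exists_hasWindows {H ψ : ℝ → ℝ} {lam c ε : ℝ} (hH : IsCircleDiffeoLift H)
    (hψ : IsCircleDiffeoLift ψ) (hlam : 1 < lam) (hc1 : 1 ≤ c) (hcl : c ≤ lam)
    (hb : ∀ x, 1 / c ≤ deriv ψ x ∧ deriv ψ x ≤ lam / c)
    (hlow : ∀ (k : ℤ) (x : ℝ), k + 1 / 2 ≤ x → x ≤ k + 1 → deriv ψ x = 1 / c)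
    (hhigh : ∀ (k : ℤ) (x : ℝ), k + 1 / 24 ≤ x → x ≤ k + 11 / 24 → deriv ψ x = lam / c)
    (hε : 0 < ε) : ∃ Q : ℝ, ∀ q : ℕ, Q ≤ q → 1 ≤ q → ∀ (α : ℝ) (p : ℤ), α ≠ p / q →
      (q : ℝ) ^ 2 * |α - p / q| ≤ 1 / 24 → ∃ (i : ℕ) (p' : ℤ) (μ : ℝ), 0 < μ ∧
        HasWindows (1 / (40 * lam)) lam ε μ i p' (rotConj (fun x => H (coverLift ψ q x)) α) := by
  have hl0 : 0 < lam := by linarith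
  have hc0 : 0 < c := by linarith
  set e := min (1 / 2) (ε / (2 * lam)) with he
  have he0 : 0 < e := by positivity
  have he2 : e ≤ 1 / 2 := min_le_left _ _
  have hel : lam * e ≤ ε / 2 := by
    have : e ≤ ε / (2 * lam) := min_le_right _ _
    rw [le_div_iff₀ (by positivity)] at this
    linarith
  obtain ⟨ρ, hρ0, hρ⟩ := hH.exists_deriv_sub_le_mul he0
  obtain ⟨m, hm0, hm⟩ := hH.exists_pos_le_deriv
  obtain ⟨L, hL0, hL⟩ := hH.exists_deriv_le
  refine ⟨max (3 * lam / ρ) (3 * L / ε), fun q hqQ hq α p hne hs => ?_⟩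
  have hq0 : (0 : ℝ) < q := by exact_mod_cast hq
  have hqρ : 3 * lam / q ≤ ρ := by
    have := (le_max_left _ _).trans hqQ
    rw [div_le_iff₀ hρ0] at this
    rw [div_le_iff₀ hq0]; linarith
  have hqε : L * (3 / q) ≤ ε := by
    have := (le_max_right _ _).trans hqQ
    rw [div_le_iff₀ hε] at this
    rw [mul_div_assoc', div_le_iff₀ hq0]; linarith
  obtain ⟨i, p', τ, hiα, hτ⟩ := exists_mul_near_half hq hne hs
  have hA := hψ.coverLift hq
  set A := coverLift ψ q with hA_def
  have hAd : ∀ x, deriv A x = deriv ψ (q * x) := fun x => hψ.deriv_coverLift hq x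
  have hH' : IsCircleDiffeoLift fun x => H (A x) := hH.comp hA
  have hlc1 : lam / c ≤ lam := div_le_self hl0.le hc1
  have hcl' : 1 / lam ≤ 1 / c := one_div_le_one_div_of_le hc0 hcl
  have hAup : ∀ {y₁ y₂ : ℝ}, y₁ ≤ y₂ → A y₂ - A y₁ ≤ lam * (y₂ - y₁) := fun {y₁ y₂} h =>
    image_sub_le_mul_sub_of_deriv_le hA.differentiable
      (fun x => (hAd x).trans_le ((hb _).2.trans hlc1)) h
  have hAlo : ∀ {y₁ y₂ : ℝ}, y₁ ≤ y₂ → 1 / lam * (y₂ - y₁) ≤ A y₂ - A y₁ := fun {y₁ y₂} h =>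
    mul_sub_le_image_sub_of_le_deriv hA.differentiable
      (fun x => (hcl'.trans (hb _).1).trans_eq (hAd x).symm) h
  have hAabs : ∀ y₁ y₂ : ℝ, |A y₁ - A y₂| ≤ lam * |y₁ - y₂| := fun y₁ y₂ => by
    rcases le_total y₁ y₂ with h | h
    · rw [abs_sub_comm, abs_sub_comm y₁, abs_of_nonneg (sub_nonneg.mpr (hA.strictMono.monotone h)),
        abs_of_nonneg (sub_nonneg.mpr h)]
      exact hAup h
    · rw [abs_of_nonneg (sub_nonneg.mpr (hA.strictMono.monotone h)),
        abs_of_nonneg (sub_nonneg.mpr h)]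
      exact hAup h
  have hclose : ∀ y₁ y₂ : ℝ, q * |y₁ - y₂| ≤ 3 →
      |deriv H (A y₁) - deriv H (A y₂)| ≤ e * deriv H (A y₂) := fun y₁ y₂ h => by
    refine hρ _ _ ((hAabs _ _).trans (le_trans ?_ hqρ))
    rw [le_div_iff₀ hq0]
    nlinarith
  set G : ℝ → ℝ := fun x => H (A x) with hG
  have hiter : (rotConj G α)^[i] = rotConj G (τ + p') := by
    rw [hH'.iterate_rotConj, hiα]
  have hval : ∀ y, rotConj G (τ + p') (G y) = G (y + τ) + p' := fun y => by
    rw [rotConj, hH'.invFun_apply, ← add_assoc, hH'.map_add_int]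
  have hder : ∀ y, deriv (rotConj G (τ + p')) (G y) =
      deriv H (A (y + τ)) * deriv ψ (q * (y + τ)) / (deriv H (A y) * deriv ψ (q * y)) := fun y => by
    have hp : deriv G (y + τ + p') = deriv G (y + τ) := by
      have := (hH'.deriv_periodic.int_mul p') (y + τ)
      rwa [mul_one] at this
    rw [hH'.deriv_rotConj, hH'.invFun_apply, ← add_assoc, hp, hH.deriv_comp hA,
      hH.deriv_comp hA, hAd, hAd]
  have hτabs : q * |τ| ≤ 1 / 2 := by
    rw [← abs_of_pos hq0, ← abs_mul, abs_le]
    rcases hτ with h | h <;> constructor <;> linarith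
  have hhpos := hH.2.2
  have hratio : ∀ y, |deriv H (A (y + τ)) / deriv H (A y) - 1| ≤ e := fun y => by
    have h0 := hhpos (A y)
    rw [div_sub_one h0.ne', abs_div, abs_of_pos h0, div_le_iff₀ h0]
    exact hclose _ _ (by rw [add_sub_cancel_left]; linarith)
  have hGlo : ∀ {y₁ y₂ : ℝ}, y₁ ≤ y₂ → m * (1 / lam * (y₂ - y₁)) ≤ G y₂ - G y₁ := fun {y₁ y₂} h =>
    (mul_le_mul_of_nonneg_left (hAlo h) hm0.le).trans
      (mul_sub_le_image_sub_of_le_deriv hH.differentiable hm (hA.strictMono.monotone h))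
  refine ⟨i, p', min (1 / (8 * lam)) (min (ε / 2) (m * (1 / lam * (1 / (2 * q))))), by positivity,
    ?_⟩
  set μ := min (1 / (8 * lam)) (min (ε / 2) (m * (1 / lam * (1 / (2 * q)))))
  have hμ1 : μ ≤ 1 / (8 * lam) := min_le_left _ _
  have hμ2 : μ ≤ ε / 2 := (min_le_right _ _).trans (min_le_left _ _)
  have hμ3 : μ ≤ m * (1 / lam * (1 / (2 * q))) := (min_le_right _ _).trans (min_le_right _ _)
  rw [HasWindows, hiter]
  refine ⟨fun x => ?_, fun x => ?_⟩
  · obtain ⟨y, rfl⟩ := hH'.surjective x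
    rw [hder, mul_div_mul_comm]
    have h1 := (abs_le.mp (hratio y)).1
    have h2 : 1 / lam ≤ deriv ψ (q * (y + τ)) / deriv ψ (q * y) := by
      rw [div_le_div_iff₀ hl0 (hψ.2.2 _)]
      have := mul_le_mul_of_nonneg_right (hb (q * (y + τ))).1 hl0.le
      calc _ ≤ lam / c := by rw [one_mul]; exact (hb _).2
        _ = 1 / c * lam := by ring
        _ ≤ _ := this
    calc 1 / (40 * lam) + μ ≤ 1 / (40 * lam) + 1 / (8 * lam) := by gcongr
      _ ≤ 1 / 2 * (1 / lam) := by
        have : 0 < 1 / lam := by positivity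
        rw [show 1 / (40 * lam) + 1 / (8 * lam) = 3 / 20 * (1 / lam) by field_simp; norm_num]
        linarith
      _ ≤ _ := by
        apply mul_le_mul _ h2 (by positivity)
        · exact (div_pos (hhpos _) (hhpos _)).le
        · linarith
  · obtain ⟨y, rfl⟩ := hH'.surjective x
    set k := ⌊q * y⌋ with hk
    have hk1 : k ≤ q * y := Int.floor_le _
    have hk2 : q * y < k + 1 := Int.lt_floor_add_one _
    have hGm : ∀ {y₁ y₂ : ℝ}, y₁ ≤ y₂ → G y₁ ≤ G y₂ := fun h => hH'.strictMono.monotone h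
    have hdiff : ∀ {w₁ w₂ : ℝ}, w₁ < w₂ → q * |w₁ - k / q| ≤ 2 → q * |w₂ - k / q| ≤ 2 →
        1 / 2 * deriv H (A (k / q)) * (A w₂ - A w₁) ≤ G w₂ - G w₁ ∧
        G w₂ - G w₁ ≤ 3 / 2 * deriv H (A (k / q)) * (A w₂ - A w₁) := by
      intro w₁ w₂ hw h1 h2
      obtain ⟨ξ, hξ1, hξ2, hξ⟩ := hH.exists_sub_eq_deriv_mul (hA.strictMono hw)
      obtain ⟨w, rfl⟩ := hA.surjective ξ
      rw [hA.strictMono.le_iff_le] at hξ1 hξ2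
      have hw' : q * |w - k / q| ≤ 2 := by
        rcases abs_cases (w - k / q) with h | h <;> rw [h.1]
        · exact (mul_le_mul_of_nonneg_left ((sub_le_sub_right hξ2 _).trans (le_abs_self _))
            hq0.le).trans h2
        · exact (mul_le_mul_of_nonneg_left ((neg_le_neg (sub_le_sub_right hξ1 _)).trans
            (neg_le_abs _)) hq0.le).trans h1
      have h3 := abs_le.mp (hclose w (k / q) (by linarith))
      have h4 : 0 ≤ A w₂ - A w₁ := (sub_pos.mpr (hA.strictMono hw)).le
      have h5 := hhpos (A (k / q))
      change _ ≤ H (A w₂) - H (A w₁) ∧ H (A w₂) - H (A w₁) ≤ _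
      rw [hξ]
      have h6 := mul_le_mul_of_nonneg_right he2 h5.le
      constructor <;> apply mul_le_mul_of_nonneg_right _ h4 <;> linarith
    have hscale : ∀ t : ℝ, q * |(k + t) / q - k / q| = |t| := fun t => by
      rw [← sub_div, add_sub_cancel_left, abs_div, abs_of_pos hq0]; field_simp
    have hlt : ∀ {t₁ t₂ : ℝ}, t₁ < t₂ → (k + t₁) / q < (k + t₂) / q := fun {t₁ t₂} h => by gcongr
    have hA3 : A ((k + 2) / q) - A ((k + (-1)) / q) = 3 / q := by
      have := hψ.coverLift_add_div hq ((k + (-1)) / q) 3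
      rw [← hA_def] at this
      rw [show ((k : ℝ) + 2) / q = (k + (-1)) / q + (3 : ℤ) / q by push_cast; ring, this]
      push_cast; ring
    refine ⟨G ((k + (-1)) / q), G ((k + 2) / q), G ((k + 7 / 12) / q), G ((k + 11 / 12) / q),
      hGm ?_, hGm ?_, hH'.strictMono (hlt (by norm_num)), ?_, hGm (hlt (by norm_num)).le,
      hGm (hlt (by norm_num)).le, ?_, fun z hz1 hz2 => ?_⟩
    · rw [div_le_iff₀ hq0]; linarith
    · rw [le_div_iff₀ hq0]; linarith
    · have := image_sub_le_mul_sub_of_deriv_le hH.differentiable hL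
        (hA.strictMono.monotone (hlt (show (-1 : ℝ) < 2 by norm_num)).le)
      rw [hA3] at this
      exact this.trans hqε
    · have h1 := (hdiff (hlt (show (-1 : ℝ) < 2 by norm_num)) (by rw [hscale]; norm_num)
        (by rw [hscale]; norm_num)).2
      have h2 := (hdiff (hlt (show (7 / 12 : ℝ) < 11 / 12 by norm_num))
        (by rw [hscale]; norm_num [abs_le]) (by rw [hscale]; norm_num [abs_le])).1
      have h3 := hAlo (hlt (show (7 / 12 : ℝ) < 11 / 12 by norm_num)).le
      rw [hA3] at h1
      have h5 := hhpos (A (k / q))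
      calc _ ≤ 1 / (40 * lam) * (3 / 2 * deriv H (A (k / q)) * (3 / q)) := by gcongr
        _ = 9 / 80 * (deriv H (A (k / q)) * (1 / lam) * (1 / q)) := by ring
        _ ≤ 1 / 6 * (deriv H (A (k / q)) * (1 / lam) * (1 / q)) :=
          mul_le_mul_of_nonneg_right (by norm_num) (by positivity)
        _ = 1 / 2 * deriv H (A (k / q)) * (1 / lam * ((k + 11 / 12) / q - (k + 7 / 12) / q)) := by
          ring
        _ ≤ _ := le_trans (by gcongr) h2
    · obtain ⟨w, rfl⟩ := hH'.surjective z
      have hw1 : k + 7 / 12 ≤ q * w := by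
        have := hH'.strictMono.le_iff_le.mp hz1
        rw [div_le_iff₀ hq0] at this; linarith
      have hw2 : q * w ≤ k + 11 / 12 := by
        have := hH'.strictMono.le_iff_le.mp hz2
        rw [le_div_iff₀ hq0] at this; linarith
      change _ ≤ rotConj G (τ + p') (G w) - _ ∧ rotConj G (τ + p') (G w) - _ ≤ _ ∧
        |deriv (rotConj G (τ + p')) (G w) - lam| + μ ≤ ε
      rw [hval, add_sub_cancel_right, hder]
      have hqτ := abs_le.mp (show |q * τ| ≤ 1 / 2 by rwa [abs_mul, abs_of_pos hq0])
      have hm' : ∀ {y₁ y₂ : ℝ}, 1 / (2 * q) ≤ y₂ - y₁ → G y₁ + μ ≤ G y₂ := fun {y₁ y₂} h => by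
        have h1 := hGlo (y₁ := y₁) (y₂ := y₂) (by linarith [show 0 < 1 / (2 * (q : ℝ)) by positivity])
        have h2 : m * (1 / lam * (1 / (2 * q))) ≤ m * (1 / lam * (y₂ - y₁)) := by gcongr
        linarith
      refine ⟨hm' ?_, ?_, ?_⟩
      · rw [div_le_iff₀ (by positivity)]
        have : (w + τ - (k + (-1)) / q) * (2 * q) = 2 * (q * w + q * τ - k + 1) := by
          field_simp; ring
        rw [this]; linarith
      · have := hm' (y₁ := w + τ) (y₂ := (k + 2) / q) (by
          rw [div_le_iff₀ (by positivity)]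
          have : ((k + 2) / q - (w + τ)) * (2 * q) = 2 * (k + 2 - q * w - q * τ) := by
            field_simp; ring
          rw [this]; linarith)
        linarith
      · rw [hlow k (q * w) (by linarith) (by linarith)]
        have : deriv ψ (q * (w + τ)) = lam / c := by
          rcases hτ with h | h
          · refine hhigh (k + 1) _ ?_ ?_ <;> push_cast <;> linarith
          · refine hhigh k _ ?_ ?_ <;> linarith
        rw [this, mul_div_mul_comm, show lam / c / (1 / c) = lam by field_simp]
        have h1 := hratio w
        have h2 := mul_le_mul_of_nonneg_left h1 hl0.le
        rw [← sub_one_mul, mul_comm, abs_mul, abs_of_pos hl0]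
        linarith

/-- The logarithm of the conjugate density to the base `lam`, modulo integers. -/
def conjPhase (lam : ℝ) (H : ℝ → ℝ) (x : ℝ) : UnitAddCircle :=
  ((Real.log (conjDensity H x) / Real.log lam : ℝ) : UnitAddCircle)

theorem exists_conjDensity_ratio_close {H : ℝ → ℝ} (hH : IsCircleDiffeoLift H) (α : ℝ) {ε : ℝ}
    (hε : 0 < ε) : ∃ η, 0 < η ∧ ∀ g : ℝ → ℝ,
      (∀ x, |g x - rotConj H α x| ≤ η ∧ |deriv g x - deriv (rotConj H α) x| ≤ η) →
        ∀ x, |conjDensity H (g x) / conjDensity H x - deriv g x| ≤ ε := by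
  obtain ⟨m, hm0, hm⟩ := hH.conjDensity_periodic.exists_pos_le hH.continuous_conjDensity
    hH.conjDensity_pos
  obtain ⟨ρ, hρ0, hρ⟩ := Metric.uniformContinuous_iff.mp
    (hH.conjDensity_periodic.uniformContinuous hH.continuous_conjDensity) (m * (ε / 2))
    (by positivity)
  refine ⟨min (ρ / 2) (ε / 2), by positivity, fun g hg x => ?_⟩
  obtain ⟨h0, h1⟩ := hg x
  have h2 := (hρ (a := g x) (b := rotConj H α x) (by
    rw [Real.dist_eq]; linarith [h0.trans (min_le_left _ _)])).le
  rw [Real.dist_eq] at h2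
  have h3 : |conjDensity H (g x) / conjDensity H x - deriv (rotConj H α) x| ≤ ε / 2 := by
    have h0 := hH.conjDensity_pos x
    rw [hH.deriv_rotConj_eq_conjDensity_div, ← sub_div, abs_div, abs_of_pos h0, div_le_iff₀ h0]
    refine h2.trans ?_
    rw [mul_comm]
    exact mul_le_mul_of_nonneg_left (hm x) (by positivity)
  have h4 := abs_sub_le (conjDensity H (g x) / conjDensity H x) (deriv (rotConj H α) x) (deriv g x)
  rw [abs_sub_comm] at h1
  linarith [h1.trans (min_le_right _ _)]

theorem conjPhase_comp_coverLift {H ψ : ℝ → ℝ} {lam c : ℝ} (hH : IsCircleDiffeoLift H)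
    (hψ : IsCircleDiffeoLift ψ) (hlam : 1 < lam) (hc : 0 < c) {q : ℕ} (hq : 1 ≤ q) {y : ℝ}
    (h : deriv ψ (q * y) = 1 / c ∨ deriv ψ (q * y) = lam / c) :
    conjPhase lam (fun y => H (coverLift ψ q y)) (H (coverLift ψ q y)) =
      conjPhase lam H (H (coverLift ψ q y)) + ((Real.log (1 / c) / Real.log lam : ℝ) :
        UnitAddCircle) := by
  have hA := hψ.coverLift hq
  have hlog : Real.log lam ≠ 0 := (Real.log_pos hlam).ne'
  have hφ := (hH.conjDensity_pos (H (coverLift ψ q y))).ne'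
  rw [conjPhase, hH.conjDensity_comp hA, (hH.comp hA).invFun_apply, hψ.deriv_coverLift hq,
    conjPhase, ← AddCircle.coe_add]
  rcases h with h | h
  · rw [h, Real.log_mul hφ (by positivity), add_div]
  · rw [h, show lam / c = 1 / c * lam by ring, Real.log_mul hφ (by positivity),
      Real.log_mul (by positivity) (by positivity), add_div, add_div, div_self hlog, ← add_assoc]
    exact AddCircle.coe_add_period 1 _

theorem volume_conjPhase_ne_le {H ψ : ℝ → ℝ} {lam c L δ : ℝ} {n M q : ℕ}
    (hH : IsCircleDiffeoLift H) (hψ : IsCircleDiffeoLift ψ) (hψ0 : ψ 0 = 0) (hlam : 1 < lam)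
    (hc : 1 ≤ c) (hψd : ∀ x, deriv ψ x ≤ lam / c) (hL : ∀ x, deriv H x ≤ L) (hq : 1 ≤ q)
    (hM : ∀ x : ℝ, |x| ≤ n → |Function.invFun H x| + 1 ≤ M)
    (hvol : volume {y : ℝ | |y| ≤ M ∧ ¬(deriv ψ (q * y) = 1 / c ∨ deriv ψ (q * y) = lam / c)} ≤
      ENNReal.ofReal δ) :
    volume {x : ℝ | |x| ≤ n ∧ conjPhase lam (fun y => H (coverLift ψ q y)) x ≠
      conjPhase lam H x + ((Real.log (1 / c) / Real.log lam : ℝ) : UnitAddCircle)} ≤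
      ENNReal.ofReal (L * lam) * ENNReal.ofReal δ := by
  have hA := hψ.coverLift hq
  have hG := hH.comp hA
  have hc0 : 0 < c := one_pos.trans_le hc
  set B := {y : ℝ | |y| ≤ M ∧ ¬(deriv ψ (q * y) = 1 / c ∨ deriv ψ (q * y) = lam / c)}
  have hd : Measurable fun y : ℝ => deriv ψ (q * y) :=
    (hψ.continuous_deriv.comp (continuous_const.mul continuous_id)).measurable
  have hB : MeasurableSet B := (measurableSet_le continuous_abs.measurable measurable_const).inter
    ((hd (measurableSet_singleton _)).union (hd (measurableSet_singleton _))).compl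
  have hsub : {x : ℝ | |x| ≤ n ∧ conjPhase lam (fun y => H (coverLift ψ q y)) x ≠
      conjPhase lam H x + ((Real.log (1 / c) / Real.log lam : ℝ) : UnitAddCircle)} ⊆
      (fun y => H (coverLift ψ q y)) '' B := by
    rintro x ⟨hx, hne⟩
    obtain ⟨y, rfl⟩ := hG.surjective x
    refine ⟨y, ⟨?_, fun h => hne (conjPhase_comp_coverLift hH hψ hlam hc0 hq h)⟩, rfl⟩
    have h1 := hM _ hx
    rw [hH.invFun_apply] at h1
    have h2 := hA.abs_sub_self_le_one (by simp [coverLift, hψ0]) y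
    have h3 := abs_sub_abs_le_abs_sub y (coverLift ψ q y)
    rw [abs_sub_comm] at h2
    linarith
  refine (measure_mono hsub).trans ((hG.volume_image_le hB fun x => ?_).trans
    (by gcongr))
  rw [hH.deriv_comp hA, hψ.deriv_coverLift hq]
  exact mul_le_mul (hL _) ((hψd _).trans (div_le_self (by linarith) hc)) (hψ.2.2 _).le
    ((hH.2.2 (coverLift ψ q x)).le.trans (hL _))

/-- The inductive step: the conjugacy `H` can be refined so that the conjugate of the rotation
changes little, the phase changes by a constant off a small set, and every diffeomorphism close
to the new conjugate has windows. -/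
theorem exists_refinement {H : ℝ → ℝ} {α lam ε : ℝ} (hH : IsCircleDiffeoLift H)
    (hα : Liouville α) (hlam : 1 < lam) (R n : ℕ) (hε : 0 < ε) :
    ∃ H' : ℝ → ℝ, IsCircleDiffeoLift H' ∧
      (∀ k ≤ R, ∀ x, |iteratedDeriv k (fun y => rotConj H' α y - rotConj H α y) x| ≤ ε) ∧
      (∀ k ≤ R, ∀ x, |iteratedDeriv k (fun y => rotConj H' (-α) y - rotConj H (-α) y) x| ≤ ε) ∧
      (∃ d : UnitAddCircle, volume {x : ℝ | |x| ≤ n ∧ conjPhase lam H' x ≠ conjPhase lam H x + d} ≤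
        ENNReal.ofReal ε) ∧
      ∃ η, 0 < η ∧ ∀ g, IsCircleDiffeoLift g →
        (∀ x, |g x - rotConj H' α x| ≤ η ∧ |deriv g x - deriv (rotConj H' α) x| ≤ η) →
        (∃ i p, HasWindows (1 / (40 * lam)) lam ε 0 i p g) ∧
        ∀ x, |conjDensity H' (g x) / conjDensity H' x - deriv g x| ≤ ε := by
  have hl0 : 0 < lam := by linarith
  obtain ⟨L, hL0, hL⟩ := hH.exists_deriv_le
  obtain ⟨K, hK⟩ := Function.Periodic.exists_abs_le (g := fun x => Function.invFun H x - x)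
    (fun x => by simp only [hH.invFun.2.1]; ring) (hH.invFun.continuous.sub continuous_id)
  obtain ⟨M, hM⟩ := exists_nat_ge (n + K + 1)
  obtain ⟨ψ, c, hψ, hψ0, hc1, hcl, hb, hlow, hhigh, hvol⟩ :=
    exists_twoSlope hlam M (δ := ε / (L * lam)) (by positivity)
  obtain ⟨C, N, hC0, hC⟩ := exists_rotConj_comp_coverLift_sub_le hH hψ R
  obtain ⟨Q, hQ⟩ := exists_hasWindows hH hψ hlam hc1 hcl hb hlow hhigh hε
  obtain ⟨q, p, hq1, hqQ, hne, hqC, hq2⟩ := hα.exists_approx C N hε Q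
  obtain ⟨i, p', μ, hμ0, hw⟩ := hQ q hqQ hq1 α p hne hq2
  have hH' := hH.comp (hψ.coverLift hq1)
  obtain ⟨η₁, hη₁0, hη₁⟩ := exists_iterate_close (hH'.rotConj α) i hμ0
  obtain ⟨η₂, hη₂0, hη₂⟩ := exists_conjDensity_ratio_close hH' α hε
  refine ⟨fun y => H (coverLift ψ q y), hH', fun k hk x => (hC q hq1 p k hk α x).trans hqC,
    fun k hk x => (hC q hq1 (-p) k hk (-α) x).trans ?_,
    ⟨((Real.log (1 / c) / Real.log lam : ℝ) : UnitAddCircle), ?_⟩,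
    min η₁ η₂, by positivity, fun g hg hgF => ⟨⟨i, p', ?_⟩, ?_⟩⟩
  · rwa [show -α - ((-p : ℤ) : ℝ) / q = -(α - p / q) by push_cast; ring, abs_neg]
  · refine (volume_conjPhase_ne_le (M := M) hH hψ hψ0 hlam hc1 (fun x => (hb x).2) hL hq1
      (fun x hx => ?_) (hvol q hq1)).trans_eq ?_
    · have h1 := hK x
      have h2 := abs_sub_abs_le_abs_sub (Function.invFun H x) x
      linarith
    · rw [← ENNReal.ofReal_mul (by positivity)]
      congr 1
      field_simp
  · have := hη₁ g hg fun x => (hgF x).imp (fun h => h.trans (min_le_left _ _))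
      fun h => h.trans (min_le_left _ _)
    exact hw.of_close (fun x => (this x).1) fun x => (this x).2
  · exact hη₂ g fun x => (hgF x).imp (fun h => h.trans (min_le_right _ _))
      fun h => h.trans (min_le_right _ _)

theorem HasWindows.mono {c lam ε ε' μ : ℝ} {i : ℕ} {p : ℤ} {g : ℝ → ℝ}
    (h : HasWindows c lam ε μ i p g) (hε : ε ≤ ε') : HasWindows c lam ε' μ i p g := by
  refine ⟨h.1, fun x => ?_⟩
  obtain ⟨a, b, u, v, hax, hxb, hab, hε', hau, hvb, huv, hz⟩ := h.2 x
  exact ⟨a, b, u, v, hax, hxb, hab, hε'.trans hε, hau, hvb, huv, fun z hz1 hz2 =>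
    ⟨(hz z hz1 hz2).1, (hz z hz1 hz2).2.1, (hz z hz1 hz2).2.2.trans hε⟩⟩

/-- Iterating `exists_refinement` with summable errors. -/
theorem exists_refinement_seq {α lam ε : ℝ} (hα : Liouville α) (hlam : 1 < lam) (R : ℕ)
    (hε : 0 < ε) : ∃ (H : ℕ → ℝ → ℝ) (η : ℕ → ℝ), (∀ x, H 0 x = x) ∧ η 0 = ε ∧ ∀ n,
      IsCircleDiffeoLift (H n) ∧ 0 < η n ∧ η (n + 1) ≤ η n / 2 ∧
      (∀ k ≤ R + n, ∀ x,
        |iteratedDeriv k (fun y => rotConj (H (n + 1)) α y - rotConj (H n) α y) x| ≤ η n / 2) ∧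
      (∀ k ≤ R + n, ∀ x,
        |iteratedDeriv k (fun y => rotConj (H (n + 1)) (-α) y - rotConj (H n) (-α) y) x| ≤
          η n / 2) ∧
      (∃ d : UnitAddCircle, volume {x : ℝ | |x| ≤ n ∧
        conjPhase lam (H (n + 1)) x ≠ conjPhase lam (H n) x + d} ≤ ENNReal.ofReal (η n)) ∧
      ∀ g, IsCircleDiffeoLift g →
        (∀ x, |g x - rotConj (H (n + 1)) α x| ≤ η (n + 1) ∧
          |deriv g x - deriv (rotConj (H (n + 1)) α) x| ≤ η (n + 1)) →
        (∃ i p, HasWindows (1 / (40 * lam)) lam (1 / (n + 1)) 0 i p g) ∧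
        ∀ x, |conjDensity (H (n + 1)) (g x) / conjDensity (H (n + 1)) x - deriv g x| ≤
          1 / (n + 1) := by
  have hstep : ∀ (s : {s : (ℝ → ℝ) × ℝ // IsCircleDiffeoLift s.1 ∧ 0 < s.2}) (n : ℕ),
      ∃ t : {s : (ℝ → ℝ) × ℝ // IsCircleDiffeoLift s.1 ∧ 0 < s.2}, t.1.2 ≤ s.1.2 / 2 ∧
      (∀ k ≤ R + n, ∀ x,
        |iteratedDeriv k (fun y => rotConj t.1.1 α y - rotConj s.1.1 α y) x| ≤ s.1.2 / 2) ∧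
      (∀ k ≤ R + n, ∀ x,
        |iteratedDeriv k (fun y => rotConj t.1.1 (-α) y - rotConj s.1.1 (-α) y) x| ≤
          s.1.2 / 2) ∧
      (∃ d : UnitAddCircle, volume {x : ℝ | |x| ≤ n ∧
        conjPhase lam t.1.1 x ≠ conjPhase lam s.1.1 x + d} ≤ ENNReal.ofReal s.1.2) ∧
      ∀ g, IsCircleDiffeoLift g →
        (∀ x, |g x - rotConj t.1.1 α x| ≤ t.1.2 ∧
          |deriv g x - deriv (rotConj t.1.1 α) x| ≤ t.1.2) →
        (∃ i p, HasWindows (1 / (40 * lam)) lam (1 / (n + 1)) 0 i p g) ∧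
        ∀ x, |conjDensity t.1.1 (g x) / conjDensity t.1.1 x - deriv g x| ≤ 1 / (n + 1) := by
    rintro ⟨⟨H, η⟩, hH, hη⟩ n
    have hη' : 0 < η := hη
    have hε0 : 0 < min (η / 2) (1 / ((n : ℝ) + 1)) := by positivity
    obtain ⟨H', hH', h1, h2, ⟨d, hd⟩, η', hη'0, h3⟩ := exists_refinement hH hα hlam (R + n) n hε0
    have hle1 := min_le_left (η / 2) (1 / ((n : ℝ) + 1))
    have hle2 := min_le_right (η / 2) (1 / ((n : ℝ) + 1))
    refine ⟨⟨⟨H', min η' (η / 2)⟩, hH', lt_min hη'0 (by linarith)⟩, min_le_right _ _,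
      fun k hk x => (h1 k hk x).trans hle1, fun k hk x => (h2 k hk x).trans hle1,
      ⟨d, hd.trans (ENNReal.ofReal_le_ofReal (hle1.trans (half_le_self hη'.le)))⟩,
      fun g hg hgF => ?_⟩
    obtain ⟨⟨i, p, hw⟩, h4⟩ := h3 g hg fun x => (hgF x).imp (fun h => h.trans (min_le_left _ _))
      fun h => h.trans (min_le_left _ _)
    exact ⟨⟨i, p, hw.mono hle2⟩, fun x => (h4 x).trans hle2⟩
  choose step h using hstep
  let s : ℕ → {s : (ℝ → ℝ) × ℝ // IsCircleDiffeoLift s.1 ∧ 0 < s.2} := fun n =>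
    Nat.rec ⟨⟨fun x => x, ε⟩, by simpa using IsCircleDiffeoLift.add_const 0, hε⟩
      (fun n s => step s n) n
  exact ⟨fun n => (s n).1.1, fun n => (s n).1.2, fun x => rfl, rfl, fun n =>
    ⟨(s n).2.1, (s n).2.2, h (s n) n⟩⟩

theorem le_div_two_pow_of_halving {η : ℕ → ℝ} (hη : ∀ n, η (n + 1) ≤ η n / 2) (n m : ℕ) :
    η (n + m) ≤ η n / 2 ^ m := by
  induction m with
  | zero => simp
  | succ m ih =>
    calc η (n + m + 1) ≤ η (n + m) / 2 := hη _
      _ ≤ η n / 2 ^ m / 2 := by gcongr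
      _ = η n / 2 ^ (m + 1) := by rw [div_div, pow_succ]

theorem tendsto_zero_of_halving {η : ℕ → ℝ} (h0 : ∀ n, 0 ≤ η n) (hη : ∀ n, η (n + 1) ≤ η n / 2) :
    Tendsto η atTop (𝓝 0) := by
  refine squeeze_zero h0 (fun n => ?_)
    ((tendsto_const_nhds (x := η 0)).div_atTop (tendsto_pow_atTop_atTop_of_one_lt one_lt_two))
  simpa using le_div_two_pow_of_halving hη 0 n

theorem exists_smooth_limit {F : ℕ → ℝ → ℝ} {η : ℕ → ℝ} (R : ℕ)
    (hF : ∀ n, ContDiff ℝ (⊤ : ℕ∞) (F n)) (hη : ∀ n, η (n + 1) ≤ η n / 2)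
    (h : ∀ n, ∀ k ≤ R + n, ∀ x, |iteratedDeriv k (fun y => F (n + 1) y - F n y) x| ≤ η n / 2) :
    ∃ f : ℝ → ℝ, ContDiff ℝ (⊤ : ℕ∞) f ∧
      ∀ n, ∀ k ≤ R + n, ∀ x, |iteratedDeriv k (fun y => f y - F n y) x| ≤ η n := by
  set D : ℕ → ℕ → ℝ → ℝ := fun n m y => F (n + m + 1) y - F (n + m) y with hD
  have hDs : ∀ n m, ContDiff ℝ (⊤ : ℕ∞) (D n m) := fun n m => (hF _).sub (hF _)
  have hbd : ∀ n k, k ≤ R + n → ∀ m x, ‖iteratedDeriv k (D n m) x‖ ≤ η n / 2 / 2 ^ m := by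
    intro n k hk m x
    have h1 := le_div_two_pow_of_halving hη n m
    calc _ ≤ η (n + m) / 2 := h (n + m) k (by omega) x
      _ ≤ η n / 2 ^ m / 2 := by gcongr
      _ = η n / 2 / 2 ^ m := by ring
  have hbd' : ∀ n (k : ℕ) m x, ((k : ℕ∞) ≤ ((R + n : ℕ) : ℕ∞)) →
      ‖iteratedFDeriv ℝ k (D n m) x‖ ≤ η n / 2 / 2 ^ m := fun n k m x hk => by
    rw [norm_iteratedFDeriv_eq_norm_iteratedDeriv]
    exact hbd n k (by exact_mod_cast hk) m x
  have hsum : ∀ n, Summable fun m : ℕ => η n / 2 / 2 ^ m := fun n =>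
    (hasSum_geometric_two' (η n)).summable
  have hDs' : ∀ n N m, ContDiff ℝ ((N : ℕ∞) : WithTop ℕ∞) (D n m) := fun n N m =>
    (hDs n m).of_le (by exact_mod_cast le_top)
  have hT : ∀ n, ContDiff ℝ (((R + n : ℕ) : ℕ∞) : WithTop ℕ∞) fun x => ∑' m, D n m x := fun n =>
    contDiff_tsum (v := fun _ m => η n / 2 / 2 ^ m) (hDs' n _) (fun k _ => hsum n)
      fun k m x hk => hbd' n k m x hk
  have hTk : ∀ n k, k ≤ R + n → ∀ x, |iteratedDeriv k (fun x => ∑' m, D n m x) x| ≤ η n := by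
    intro n k hk x
    rw [← Real.norm_eq_abs, ← norm_iteratedFDeriv_eq_norm_iteratedDeriv,
      iteratedFDeriv_tsum_apply (v := fun _ m => η n / 2 / 2 ^ m) (N := ((R + n : ℕ) : ℕ∞))
        (hDs' n _) (fun k _ => hsum n) (fun k m x hk => hbd' n k m x hk) (by exact_mod_cast hk)]
    exact tsum_of_norm_bounded (hasSum_geometric_two' (η n)) fun m =>
      hbd' n k m x (by exact_mod_cast hk)
  have hlim : ∀ n x, Tendsto (fun m => F (n + m) x) atTop (𝓝 (F n x + ∑' m, D n m x)) := by
    intro n x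
    have hs : Summable fun m => D n m x := Summable.of_norm_bounded (hsum n) fun m => by
      simpa using hbd n 0 (by omega) m x
    have := (hs.hasSum.tendsto_sum_nat).const_add (F n x)
    refine this.congr fun m => ?_
    have := Finset.sum_range_sub (fun m => F (n + m) x) m
    simp only [hD]
    simp only [add_zero, ← add_assoc] at this
    rw [this]; ring
  set f : ℝ → ℝ := fun x => F 0 x + ∑' m, D 0 m x with hf
  have hfn : ∀ n x, f x = F n x + ∑' m, D n m x := fun n x => by
    refine tendsto_nhds_unique ?_ (hlim n x)
    have := (tendsto_add_atTop_iff_nat n).mpr (hlim 0 x)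
    refine this.congr fun m => ?_
    rw [zero_add, add_comm]
  refine ⟨f, contDiff_infty.mpr fun N => ?_, fun n k hk x => ?_⟩
  · rw [show f = fun x => F N x + ∑' m, D N m x from funext (hfn N)]
    refine ((hF N).of_le (by exact_mod_cast le_top)).add ((hT N).of_le ?_)
    exact_mod_cast Nat.le_add_left N R
  · have : (fun y => f y - F n y) = fun x => ∑' m, D n m x := funext fun y => by
      rw [hfn n]; ring
    rw [this]
    exact hTk n k hk x

theorem tendsto_of_abs_sub_le {F : ℕ → ℝ → ℝ} {f : ℝ → ℝ} {η : ℕ → ℝ} (hη : Tendsto η atTop (𝓝 0))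
    (h : ∀ n x, |f x - F n x| ≤ η n) (x : ℝ) : Tendsto (fun n => F n x) atTop (𝓝 (f x)) := by
  rw [tendsto_iff_dist_tendsto_zero]
  refine squeeze_zero (fun n => dist_nonneg) (fun n => ?_) hη
  rw [dist_comm]
  exact h n x

theorem comp_eq_id_of_tendsto {F G : ℕ → ℝ → ℝ} {f g : ℝ → ℝ} {η : ℕ → ℝ}
    (hη : Tendsto η atTop (𝓝 0)) (hf : Continuous f) (h1 : ∀ n x, |f x - F n x| ≤ η n)
    (h2 : ∀ n x, |g x - G n x| ≤ η n) (hFG : ∀ n x, F n (G n x) = x) (x : ℝ) : f (g x) = x := by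
  refine tendsto_nhds_unique ((hf.tendsto _).comp (tendsto_of_abs_sub_le hη h2 x)) ?_
  rw [tendsto_iff_dist_tendsto_zero]
  refine squeeze_zero (fun n => dist_nonneg) (fun n => ?_) hη
  have := h1 n (G n x)
  rwa [hFG] at this

/-- A sequence of conjugates of a rotation that converges fast has a diffeomorphism as its limit. -/
theorem exists_diffeo_limit {H : ℕ → ℝ → ℝ} {η : ℕ → ℝ} {α : ℝ} {R : ℕ} (hR : 1 ≤ R)
    (hH : ∀ n, IsCircleDiffeoLift (H n)) (h0 : ∀ n, 0 ≤ η n) (hη : ∀ n, η (n + 1) ≤ η n / 2)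
    (h1 : ∀ n, ∀ k ≤ R + n, ∀ x,
      |iteratedDeriv k (fun y => rotConj (H (n + 1)) α y - rotConj (H n) α y) x| ≤ η n / 2)
    (h2 : ∀ n, ∀ k ≤ R + n, ∀ x,
      |iteratedDeriv k (fun y => rotConj (H (n + 1)) (-α) y - rotConj (H n) (-α) y) x| ≤
        η n / 2) :
    ∃ f : ℝ → ℝ, IsCircleDiffeoLift f ∧
      (∀ n, ∀ k ≤ R + n, ∀ x, |iteratedDeriv k (fun y => f y - rotConj (H n) α y) x| ≤ η n) ∧
      ∀ n, ∀ k ≤ R + n, ∀ x,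
        |iteratedDeriv k (fun y => Function.invFun f y - rotConj (H n) (-α) y) x| ≤ η n := by
  obtain ⟨f, hf, hfk⟩ := exists_smooth_limit R (fun n => ((hH n).rotConj α).1) hη h1
  obtain ⟨g, hg, hgk⟩ := exists_smooth_limit R (fun n => ((hH n).rotConj (-α)).1) hη h2
  have hη0 := tendsto_zero_of_halving h0 hη
  have hf0 : ∀ n x, |f x - rotConj (H n) α x| ≤ η n := fun n x => by
    simpa using hfk n 0 (by omega) x
  have hg0 : ∀ n x, |g x - rotConj (H n) (-α) x| ≤ η n := fun n x => by
    simpa using hgk n 0 (by omega) x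
  have hfg : ∀ x, f (g x) = x := comp_eq_id_of_tendsto hη0 hf.continuous hf0 hg0 fun n x => by
    rw [(hH n).rotConj_rotConj, neg_add_cancel, (hH n).rotConj_zero]
  have hgf : ∀ x, g (f x) = x := comp_eq_id_of_tendsto hη0 hg.continuous hg0 hf0 fun n x => by
    rw [(hH n).rotConj_rotConj, add_neg_cancel, (hH n).rotConj_zero]
  have hfd : Differentiable ℝ f := hf.differentiable (by simp)
  have hgd : Differentiable ℝ g := hg.differentiable (by simp)
  have hfl : IsCircleDiffeoLift f := by
    refine ⟨hf, fun x => ?_, fun x => ?_⟩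
    · refine tendsto_nhds_unique (tendsto_of_abs_sub_le hη0 hf0 (x + 1)) ?_
      simp only [((hH _).rotConj α).2.1]
      exact (tendsto_of_abs_sub_le hη0 hf0 x).add_const 1
    · have hnn : 0 ≤ deriv f x := by
        refine ge_of_tendsto (f := fun n => deriv f x + η n)
          (by simpa using hη0.const_add (deriv f x))
          (Eventually.of_forall fun n => ?_)
        have := hfk n 1 (by omega) x
        rw [iteratedDeriv_one, deriv_fun_sub (hfd x) (((hH n).rotConj α).differentiable x)] at this
        linarith [(abs_le.mp this).1, ((hH n).rotConj α).2.2 x]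
      refine lt_of_le_of_ne hnn fun h => ?_
      have h3 : HasDerivAt (fun y => g (f y)) (deriv g (f x) * deriv f x) x :=
        (hgd (f x)).hasDerivAt.comp x (hfd x).hasDerivAt
      rw [funext hgf, ← h, mul_zero] at h3
      exact zero_ne_one (h3.unique (hasDerivAt_id x))
  refine ⟨f, hfl, hfk, ?_⟩
  rw [hfl.invFun_eq_of_leftInverse hfg]
  exact hgk

theorem crNorm_le {r : ℕ} {φ : ℝ → ℝ} {C : ℝ}
    (h : ∀ k ≤ r, ∀ x, |iteratedDeriv k φ x| ≤ C) : CrNorm r φ ≤ C :=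
  Finset.sup'_le _ _ fun k hk => ciSup_le (h k (Nat.lt_succ_iff.mp (Finset.mem_range.mp hk)))

theorem rotConj_of_eq_self {H : ℝ → ℝ} (hH : IsCircleDiffeoLift H) (h : ∀ x, H x = x) (a : ℝ) :
    rotConj H a = RotLift a := by
  ext x
  have := hH.invFun_apply x
  rw [h] at this
  simp only [rotConj, RotLift, h, this]

theorem liftDist_rotLift_le {r : ℕ} {α C : ℝ} {H f : ℝ → ℝ} (hH : IsCircleDiffeoLift H)
    (h : ∀ x, H x = x) (h1 : ∀ k ≤ r, ∀ x, |iteratedDeriv k (fun y => f y - rotConj H α y) x| ≤ C)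
    (h2 : ∀ k ≤ r, ∀ x,
      |iteratedDeriv k (fun y => Function.invFun f y - rotConj H (-α) y) x| ≤ C) :
    liftDist r f (RotLift α) ≤ C := by
  have e : Function.invFun (RotLift α) = RotLift (-α) :=
    (IsCircleDiffeoLift.add_const α).invFun_eq_of_leftInverse fun x => by simp [RotLift]
  rw [liftDist, e, ← rotConj_of_eq_self hH h, ← rotConj_of_eq_self hH h]
  exact max_le (crNorm_le h1) (crNorm_le h2)

/-- A `C¹` limit of lifts conjugate to the translation by `α` has rotation number `α`. -/
theorem hasRotationNumber_of_close {f : ℝ → ℝ} {α : ℝ} (hf : IsCircleDiffeoLift f)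
    (h : ∀ η, 0 < η → ∃ H, IsCircleDiffeoLift H ∧ ∀ x, |f x - rotConj H α x| ≤ η ∧
      |deriv f x - deriv (rotConj H α) x| ≤ η) : HasRotationNumber f α := by
  have hbd : ∀ n : ℕ, |f^[n] 0 - n * α| ≤ 2 := fun n => by
    obtain ⟨η, hη, hηg⟩ := exists_iterate_close hf n one_pos
    obtain ⟨H, hH, hHf⟩ := h η hη
    have h1 := (hηg _ (hH.rotConj α) (fun x => by
      rw [abs_sub_comm, abs_sub_comm (deriv _ x)]; exact hHf x) 0).1
    rw [hH.iterate_rotConj, abs_sub_comm] at h1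
    have h2 := hH.abs_rotConj_zero_sub_le (n * α)
    linarith [abs_sub_le (f^[n] 0) (rotConj H (n * α) 0) (n * α)]
  refine ⟨0, ?_⟩
  rw [Int.cast_zero, add_zero, tendsto_iff_dist_tendsto_zero]
  refine squeeze_zero' (Eventually.of_forall fun n => dist_nonneg) ?_
    (tendsto_const_div_atTop_nhds_zero_nat 2)
  filter_upwards [eventually_gt_atTop 0] with n hn
  have hn' : (0 : ℝ) < n := by exact_mod_cast hn
  rw [Real.dist_eq, div_sub' hn'.ne', abs_div, abs_of_pos hn']
  gcongr
  exact hbd n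

/-- Windows of every small scale that are mapped close to themselves by iterates with derivative
close to `lam` force `lam` to lie in the ratio set. -/
theorem IsCircleDiffeoLift.mem_liftRatioSet_of_hasWindows {f : ℝ → ℝ} {c lam : ℝ}
    (hf : IsCircleDiffeoLift f) (hc : 0 < c) (hlam : 0 ≤ lam)
    (h : ∀ n : ℕ, ∃ i p, HasWindows c lam (1 / (n + 1)) 0 i p f) : lam ∈ liftRatioSet f := by
  refine ⟨hlam, fun A hA hAp hA0 ε hε => ?_⟩
  have hAz : ∀ (p : ℤ) (x : ℝ), x - p ∈ A ↔ x ∈ A := by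
    have hper : Function.Periodic (fun x => x ∈ A) 1 := fun x => propext (hAp x)
    intro p x
    have := hper.sub_zsmul_eq p (x := x)
    simp only [zsmul_eq_mul, mul_one] at this
    rw [this]
  have hae := IsUnifLocDoublingMeasure.ae_tendsto_measure_inter_div (volume : Measure ℝ) A 1
  have : NeBot (ae (volume.restrict A)) := by
    rw [ae_neBot]
    intro h0
    rw [Measure.restrict_eq_zero] at h0
    exact hA0.ne' h0
  obtain ⟨x, hx⟩ := hae.exists
  choose i p hw using h
  choose a b u v hax hxb hab hle hau hvb huv hz using fun n => (hw n).2 x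
  have hδ : Tendsto (fun n => (b n - a n) / 2) atTop (𝓝[>] 0) := by
    refine tendsto_nhdsWithin_iff.mpr ⟨?_, Eventually.of_forall fun n => ?_⟩
    · refine squeeze_zero (fun n => by linarith [hab n]) (fun n => ?_)
        tendsto_one_div_add_atTop_nhds_zero_nat
      linarith [hle n, hab n]
    · simpa using hab n
  have hlim := hx (fun n => (a n + b n) / 2) (fun n => (b n - a n) / 2) hδ
    (Eventually.of_forall fun n => by
      rw [Real.closedBall_eq_Icc]
      exact ⟨by linarith [hax n], by linarith [hxb n]⟩)
  have hball : ∀ n,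
      Metric.closedBall ((a n + b n) / 2) ((b n - a n) / 2) = Set.Icc (a n) (b n) := by
    intro n
    rw [Real.closedBall_eq_Icc]; congr 1 <;> ring
  simp only [hball, Real.volume_Icc] at hlim
  set κ := c / (2 * (1 + 1 / c)) with hκ
  have hκ0 : 0 < κ := by positivity
  have h1 : ∀ᶠ n in atTop, ENNReal.ofReal (1 - κ) <
      volume (A ∩ Set.Icc (a n) (b n)) / ENNReal.ofReal (b n - a n) :=
    hlim.eventually (lt_mem_nhds (by
      rw [← ENNReal.ofReal_one]; exact (ENNReal.ofReal_lt_ofReal_iff one_pos).mpr (by linarith)))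
  have h2 : ∀ᶠ n : ℕ in atTop, 1 / ((n : ℝ) + 1) < ε :=
    tendsto_one_div_add_atTop_nhds_zero_nat.eventually (gt_mem_nhds hε)
  obtain ⟨n, hn1, hn2⟩ := (h1.and h2).exists
  have hzp : _root_.zpowLift f (i n : ℤ) = f^[i n] := by simp [_root_.zpowLift]
  refine ⟨i n, ?_⟩
  rw [hzp]
  have hF := hf.iterate (i n)
  have hba : 0 < b n - a n := sub_pos.mpr (hab n)
  -- the part of the window outside `A`
  set E := Set.Icc (a n) (b n) \ A with hE
  have hEm : MeasurableSet E := measurableSet_Icc.diff hA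
  have hEfin : volume E ≠ ⊤ := ((measure_mono Set.sdiff_subset).trans_lt (by simp)).ne
  have hEle : volume.real E ≤ κ * (b n - a n) := by
    have h3 : volume.real (A ∩ Set.Icc (a n) (b n)) + volume.real E = b n - a n := by
      have := measureReal_inter_add_sdiff (μ := volume) (s := Set.Icc (a n) (b n)) hA
        (by simp)
      rw [Set.inter_comm] at this
      rw [this, Real.volume_real_Icc_of_le (hab n).le]
    have h4 : (1 - κ) * (b n - a n) ≤ volume.real (A ∩ Set.Icc (a n) (b n)) := by
      have hfin : volume (A ∩ Set.Icc (a n) (b n)) ≠ ⊤ :=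
        ((measure_mono Set.inter_subset_right).trans_lt (by simp)).ne
      have := (ENNReal.lt_div_iff_mul_lt (by simp) (by simp)).mp hn1
      rw [← ENNReal.ofReal_mul' hba.le] at this
      exact (ENNReal.ofReal_le_iff_le_toReal hfin).mp this.le
    linarith
  set T := f^[i n] with hT
  set E' := {z | T z - p n ∈ E} with hE'
  have hE'm : MeasurableSet E' := (hF.continuous.sub continuous_const).measurable hEm
  have hE'le : ENNReal.ofReal c * volume E' ≤ volume E := by
    have hc' : ∀ x, c ≤ deriv T x := fun x => by simpa using (hw n).1 x
    refine (hF.le_volume_image hE'm hc').trans ?_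
    rw [← measure_preimage_add_right volume (-(p n : ℝ)) E]
    refine measure_mono ?_
    rintro _ ⟨z, hzE, rfl⟩
    exact hzE
  have hE'fin : volume E' ≠ ⊤ := fun htop => by
    rw [htop, ENNReal.mul_top (by simpa using hc)] at hE'le
    exact hEfin (top_le_iff.mp hE'le)
  have hE'le' : volume.real E' ≤ κ * (b n - a n) / c := by
    have := ENNReal.toReal_mono hEfin hE'le
    rw [ENNReal.toReal_mul, ENNReal.toReal_ofReal hc.le] at this
    rw [le_div_iff₀ hc]
    change c * volume.real E' ≤ volume.real E at this
    linarith
  have hsub : Set.Icc (u n) (v n) ⊆ {x | x ∈ A ∧ T x ∈ A ∧ |deriv T x - lam| < ε} ∪ (E ∪ E') := by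
    intro z hzz
    obtain ⟨h5, h6, h7⟩ := hz n z hzz.1 hzz.2
    by_cases hzA : z ∈ A
    · by_cases hTA : T z ∈ A
      · exact Or.inl ⟨hzA, hTA, by linarith⟩
      · exact Or.inr (Or.inr ⟨⟨by linarith, by linarith⟩, fun hh => hTA ((hAz _ _).mp hh)⟩)
    · exact Or.inr (Or.inl ⟨⟨(hau n).trans hzz.1, hzz.2.trans (hvb n)⟩, hzA⟩)
  rw [pos_iff_ne_zero]
  intro h0
  have h8 : volume (Set.Icc (u n) (v n)) ≤ volume (E ∪ E') := by
    refine (measure_mono hsub).trans ((measure_union_le _ _).trans ?_)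
    rw [h0, zero_add]
  have h9 : v n - u n ≤ volume.real E + volume.real E' := by
    have h10 := ENNReal.toReal_mono (by
      exact ((measure_union_le _ _).trans_lt (ENNReal.add_lt_top.mpr
        ⟨hEfin.lt_top, hE'fin.lt_top⟩)).ne) h8
    rw [Real.volume_Icc, ENNReal.toReal_ofReal'] at h10
    exact (le_max_left _ _).trans (h10.trans (measureReal_union_le E E'))
  have h11 : κ * (b n - a n) + κ * (b n - a n) / c = c / 2 * (b n - a n) := by
    rw [hκ]; field_simp
  have := huv n
  nlinarith [mul_pos hc hba]

/-- A chain rule for functions that are asymptotically densities of invariant measures. -/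
theorem IsCircleDiffeoLift.tendsto_div_deriv_zpowLift {f : ℝ → ℝ} {φ : ℕ → ℝ → ℝ}
    (hf : IsCircleDiffeoLift f) (hφ : ∀ n x, 0 < φ n x)
    (h : ∀ x, Tendsto (fun n => φ n (f x) / φ n x) atTop (𝓝 (deriv f x))) (i : ℤ) (x : ℝ) :
    Tendsto (fun n => φ n (_root_.zpowLift f i x) / φ n x) atTop
      (𝓝 (deriv (_root_.zpowLift f i) x)) := by
  have hnat : ∀ (k : ℕ) (x : ℝ),
      Tendsto (fun n => φ n (f^[k] x) / φ n x) atTop (𝓝 (deriv f^[k] x)) := by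
    intro k
    induction k with
    | zero =>
      intro x
      simp [(hφ _ _).ne']
    | succ k ih =>
      intro x
      have hk := (h (f^[k] x)).mul (ih x)
      have e : deriv f^[k + 1] x = deriv f (f^[k] x) * deriv f^[k] x := by
        rw [Function.iterate_succ']; exact hf.deriv_comp (hf.iterate k) x
      rw [e]
      refine hk.congr fun n => ?_
      rw [Function.iterate_succ_apply', div_mul_div_cancel₀ (hφ _ _).ne']
  have hz : ∀ k : ℕ, _root_.zpowLift f (k : ℤ) = f^[k] := fun k => by simp [_root_.zpowLift]
  obtain ⟨k, rfl | rfl⟩ := i.eq_nat_or_neg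
  · rw [hz]; exact hnat k x
  · obtain ⟨y, rfl⟩ : ∃ y, _root_.zpowLift f k y = x := ⟨_, hf.zpowLift_apply_neg k x⟩
    rw [hf.deriv_zpowLift_neg]
    simp only [hf.zpowLift_neg_apply]
    simp only [hz]
    exact ((hnat k y).inv₀ ((hf.iterate k).2.2 _).ne').congr fun n => inv_div _ _

theorem ae_eventually_const {X : Type*} {Θ : ℕ → ℝ → X} {η : ℕ → ℝ} (h0 : ∀ n, 0 ≤ η n)
    (hη : ∀ n, η (n + 1) ≤ η n / 2)
    (h : ∀ n : ℕ, volume {x : ℝ | |x| ≤ n ∧ Θ (n + 1) x ≠ Θ n x} ≤ ENNReal.ofReal (η n)) :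
    ∀ᵐ x : ℝ, ∃ N, ∀ n ≥ N, Θ n x = Θ N x := by
  have hs : Summable η := by
    refine Summable.of_nonneg_of_le h0 (fun n => ?_) (summable_geometric_two.mul_left (η 0))
    have := le_div_two_pow_of_halving hη 0 n
    rw [zero_add] at this
    rwa [one_div_pow, mul_one_div]
  have hsum : ∑' n : ℕ, volume {x : ℝ | |x| ≤ n ∧ Θ (n + 1) x ≠ Θ n x} ≠ ⊤ :=
    ((ENNReal.tsum_le_tsum h).trans_lt (ENNReal.ofReal_tsum_of_nonneg h0 hs ▸
      ENNReal.ofReal_lt_top)).ne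
  filter_upwards [MeasureTheory.ae_eventually_notMem hsum] with x hx
  obtain ⟨M, hM⟩ := exists_nat_ge |x|
  obtain ⟨N, hN⟩ := eventually_atTop.mp (hx.and (eventually_ge_atTop M))
  refine ⟨N, fun n hn => ?_⟩
  induction n, hn using Nat.le_induction with
  | base => rfl
  | succ n hn ih =>
    have := (hN n hn).1
    simp only [not_and, not_not] at this
    rw [← ih]
    exact this (hM.trans (by exact_mod_cast (hN n hn).2))

/-- A sequence of periodic continuous functions that is almost everywhere eventually constant has
small oscillation, uniformly in the index, on a periodic set of positive measure. -/
theorem exists_periodic_set_small_oscillation {X : Type*} [MetricSpace X]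
    [TopologicalSpace.SeparableSpace X] [Nonempty X] {Θ : ℕ → ℝ → X} (hc : ∀ n, Continuous (Θ n))
    (hp : ∀ n, Function.Periodic (Θ n) 1) (h : ∀ᵐ x : ℝ, ∃ N, ∀ n ≥ N, Θ n x = Θ N x) {δ : ℝ}
    (hδ : 0 < δ) : ∃ (A : Set ℝ) (N : ℕ), MeasurableSet A ∧ (∀ x, x + 1 ∈ A ↔ x ∈ A) ∧
      0 < volume A ∧ ∀ x ∈ A, ∀ y ∈ A, ∀ n ≥ N, dist (Θ n x) (Θ n y) < δ := by
  set S : ℕ × ℕ → Set ℝ := fun k =>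
    {x | ∀ n ≥ k.1, Θ n x = Θ k.1 x} ∩
      {x | dist (Θ k.1 x) (TopologicalSpace.denseSeq X k.2) < δ / 2} with hS
  have hpos : ∃ k, 0 < volume (S k) := by
    by_contra! h0
    have hnull : volume (⋃ k, S k) = 0 := measure_iUnion_null fun k => by simpa using h0 k
    have hbot : ∀ᵐ x : ℝ, False := by
      filter_upwards [h, measure_eq_zero_iff_ae_notMem.mp hnull] with x ⟨N, hN⟩ hx
      obtain ⟨j, hj⟩ :=
        (TopologicalSpace.denseRange_denseSeq X).exists_dist_lt (Θ N x) (half_pos hδ)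
      exact hx (Set.mem_iUnion.mpr ⟨(N, j), hN, hj⟩)
    exact hbot.exists.elim fun _ => id
  obtain ⟨⟨N, j⟩, hk⟩ := hpos
  refine ⟨S (N, j), N, ?_, fun x => ?_, hk, fun x hx y hy n hn => ?_⟩
  · refine MeasurableSet.inter ?_
      (isOpen_lt ((hc N).dist continuous_const) continuous_const).measurableSet
    have : {x | ∀ n ≥ N, Θ n x = Θ N x} = ⋂ n, ⋂ (_ : n ≥ N), {x | Θ n x = Θ N x} := by
      ext; simp
    change MeasurableSet {x | ∀ n ≥ N, Θ n x = Θ N x}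
    rw [this]
    exact (isClosed_iInter fun n => isClosed_iInter fun _ =>
      isClosed_eq (hc n) (hc N)).measurableSet
  · simp only [hS, Set.mem_inter_iff, Set.mem_ofPred_eq, (hp _) x]
  · rw [hx.1 n hn, hy.1 n hn]
    have h1 := hx.2
    have h2 := hy.2
    simp only [Set.mem_ofPred_eq] at h1 h2
    linarith [dist_triangle_right (Θ N x) (Θ N y) (TopologicalSpace.denseSeq X j)]

theorem continuous_conjPhase {lam : ℝ} {H : ℝ → ℝ} (hH : IsCircleDiffeoLift H) :
    Continuous (conjPhase lam H) :=
  (AddCircle.continuous_mk' 1).comp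
    ((hH.continuous_conjDensity.log fun x => (hH.conjDensity_pos x).ne').div_const _)

/-- If the phases of asymptotically invariant densities stabilise, modulo constants, almost
everywhere, then the ratio set consists of powers of `lam`. -/
theorem IsCircleDiffeoLift.liftRatioSet_subset {f : ℝ → ℝ} {lam : ℝ} {H : ℕ → ℝ → ℝ} {η : ℕ → ℝ}
    (hf : IsCircleDiffeoLift f) (hlam : 1 < lam) (hH : ∀ n, IsCircleDiffeoLift (H n))
    (h0 : ∀ n, 0 ≤ η n) (hη : ∀ n, η (n + 1) ≤ η n / 2)
    (hd : ∀ n : ℕ, ∃ d : UnitAddCircle, volume {x : ℝ | |x| ≤ n ∧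
        conjPhase lam (H (n + 1)) x ≠ conjPhase lam (H n) x + d} ≤ ENNReal.ofReal (η n))
    (h : ∀ x, Tendsto (fun n => conjDensity (H n) (f x) / conjDensity (H n) x) atTop
      (𝓝 (deriv f x))) :
    liftRatioSet f ⊆ {t | ∃ n : ℤ, t = lam ^ n} ∪ {0} := by
  choose d hd using hd
  rintro t ⟨ht, htA⟩
  rcases ht.eq_or_lt with rfl | ht
  · exact Or.inr rfl
  left
  have hlog : 0 < Real.log lam := Real.log_pos hlam
  set Θ : ℕ → ℝ → UnitAddCircle := fun n x =>
    conjPhase lam (H n) x - ∑ k ∈ Finset.range n, d k with hΘ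
  have hΘc : ∀ n, Continuous (Θ n) := fun n => (continuous_conjPhase (hH n)).sub continuous_const
  have hΘp : ∀ n, Function.Periodic (Θ n) 1 := fun n x => by
    simp only [hΘ, conjPhase, (hH n).conjDensity_periodic x]
  have hΘe : ∀ᵐ x : ℝ, ∃ N, ∀ n ≥ N, Θ n x = Θ N x := by
    refine ae_eventually_const h0 hη fun n => (measure_mono ?_).trans (hd n)
    rintro x ⟨hx, hne⟩
    refine ⟨hx, fun he => hne ?_⟩
    simp only [hΘ, he, Finset.sum_range_succ]
    abel
  set L : ℝ → UnitAddCircle := fun s => ((Real.log s / Real.log lam : ℝ) : UnitAddCircle) with hL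
  have hLc : ∀ s, 0 < s → ContinuousAt L s := fun s hs =>
    (AddCircle.continuous_mk' (1 : ℝ)).continuousAt.comp
      ((Real.continuousAt_log hs.ne').div_const _)
  have hLt : L t = 0 := by
    refine norm_le_zero_iff.mp (le_of_forall_pos_le_add fun δ hδ => ?_)
    obtain ⟨A, N, hA, hAp, hA0, hosc⟩ :=
      exists_periodic_set_small_oscillation hΘc hΘp hΘe (half_pos hδ)
    obtain ⟨ρ, hρ, hρL⟩ := Metric.continuousAt_iff.mp (hLc t ht) (δ / 2) (half_pos hδ)
    obtain ⟨i, hi⟩ := htA A hA hAp hA0 ρ hρ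
    obtain ⟨x, hxA, hixA, hxt⟩ := nonempty_of_measure_ne_zero hi.ne'
    have hpos := (hf.zpowLift i).2.2 x
    have hlim := ((hLc _ hpos).tendsto.comp (hf.tendsto_div_deriv_zpowLift
      (fun n x => (hH n).conjDensity_pos x) h i x)).norm
    have hle : ‖L (deriv (_root_.zpowLift f i) x)‖ ≤ δ / 2 := by
      refine le_of_tendsto hlim ?_
      filter_upwards [eventually_ge_atTop N] with n hn
      have := hosc _ hixA _ hxA n hn
      rw [dist_eq_norm] at this
      refine le_trans (le_of_eq ?_) this.le
      congr 1
      simp only [hΘ, hL, Function.comp, conjPhase, sub_sub_sub_cancel_right]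
      rw [Real.log_div ((hH n).conjDensity_pos _).ne' ((hH n).conjDensity_pos _).ne', sub_div,
        AddCircle.coe_sub]
    have h1 := hρL (by rwa [Real.dist_eq])
    have h2 := norm_le_norm_add_norm_sub' (L t) (L (deriv (_root_.zpowLift f i) x))
    rw [dist_comm, dist_eq_norm] at h1
    linarith
  obtain ⟨n, hn⟩ := AddCircle.coe_eq_zero_iff (1 : ℝ) |>.mp hLt
  refine ⟨n, ?_⟩
  rw [zsmul_eq_mul, mul_one, eq_div_iff hlog.ne', ← Real.log_zpow] at hn
  exact (Real.log_injOn_pos (zpow_pos (by linarith : (0 : ℝ) < lam) n) ht hn).symm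

/-- For a Liouville number `α ∈ (0,1)`, `λ > 1` and any `r`, there is a type `III_λ` smooth
circle diffeomorphism with rotation number `α` whose lift is `2^{-r}`-close to `R_α` in `d_r`. -/
theorem stmt_6 (α : ℝ) (hα0 : 0 < α) (hα1 : α < 1) (hL : Liouville α)
    (lam : ℝ) (hlam : 1 < lam) (r : ℕ) :
    ∃ f : ℝ → ℝ, IsCircleDiffeoLift f ∧ HasRotationNumber f α ∧
      liftDist r f (RotLift α) < ((2 : ℝ) ^ r)⁻¹ ∧
      ∃ Fz : ℤ → UnitAddCircle → UnitAddCircle, ∃ D : ℤ → UnitAddCircle → ℝ,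
        (∀ i : ℤ, ∀ x : ℝ, Fz i ↑x = ↑(zpowLift f i x)) ∧
        (∀ i : ℤ, ∀ x : ℝ, D i ↑x = deriv (zpowLift f i) x) ∧
        ratioSet Fz D = {t : ℝ | ∃ n : ℤ, t = lam ^ n} ∪ {0} := by
  obtain ⟨H, η, hid, hη0, hall⟩ :=
    exists_refinement_seq hL hlam (r + 1) (ε := ((2 : ℝ) ^ r)⁻¹ / 2) (by positivity)
  choose hH hpos hη h1 h2 hd hg using hall
  have hnn : ∀ n, 0 ≤ η n := fun n => (hpos n).le
  obtain ⟨f, hf, hf1, hf2⟩ := exists_diffeo_limit (by omega) hH hnn hη h1 h2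
  have hclose : ∀ n x, |f x - rotConj (H n) α x| ≤ η n ∧
      |deriv f x - deriv (rotConj (H n) α) x| ≤ η n := fun n x => by
    have hc0 := hf1 n 0 (by omega) x
    have hc1 := hf1 n 1 (by omega) x
    rw [iteratedDeriv_zero] at hc0
    rw [iteratedDeriv_one, deriv_fun_sub (hf.differentiable x)
      (((hH n).rotConj α).differentiable x)] at hc1
    exact ⟨hc0, hc1⟩
  have hwin := fun n => hg n f hf (hclose (n + 1))
  have hmem : lam ∈ liftRatioSet f :=
    hf.mem_liftRatioSet_of_hasWindows (by positivity) (by linarith) fun n => (hwin n).1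
  have hlim : ∀ x, Tendsto (fun n => conjDensity (H n) (f x) / conjDensity (H n) x) atTop
      (𝓝 (deriv f x)) := fun x => by
    rw [← tendsto_add_atTop_iff_nat 1, tendsto_iff_dist_tendsto_zero]
    exact squeeze_zero (fun n => dist_nonneg) (fun n => (hwin n).2 x)
      tendsto_one_div_add_atTop_nhds_zero_nat
  refine ⟨f, hf, hasRotationNumber_of_close hf fun e he => ?_, ?_, ?_⟩
  · obtain ⟨n, hn⟩ := ((tendsto_zero_of_halving hnn hη).eventually (gt_mem_nhds he)).exists
    exact ⟨H n, hH n, fun x =>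
      ⟨(hclose n x).1.trans hn.le, (hclose n x).2.trans hn.le⟩⟩
  · have hle : liftDist r f (RotLift α) ≤ η 0 := liftDist_rotLift_le (hH 0) hid
      (fun k hk => hf1 0 k (by omega)) fun k hk => hf2 0 k (by omega)
    rw [hη0] at hle
    exact hle.trans_lt (half_lt_self (by positivity))
  · obtain ⟨Fz, D, hFz, hD⟩ := exists_circle_iterates hf
    refine ⟨Fz, D, hFz, hD, ?_⟩
    rw [ratioSet_eq_liftRatioSet hf hFz hD]
    exact Set.Subset.antisymm (hf.liftRatioSet_subset hlam hH hnn hη hd hlim)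
      (hf.zpow_subset_liftRatioSet hlam hmem)
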